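/- arXiv:1303.4345 — 3 statements merged into one kernel-verified Lean document; each statement's English description precedes it below -/
import Mathlib

section
/- Suppose additionally that there exists a function g ∈ L¹(Ω) with J(x,y) ≤ g(x) for almost every (x,y) ∈ Ω × Ω, and that lim_{λ→(−inf a)⁺} spr(A_λ) > 1, where spr denotes spectral radius. Then L has a principal eigenvalue: there exist λ₀ ∈ ℝ with λ₀ > −inf a and a nonzero u ∈ L¹(Ω) with u ≥ 0 a.e. such that Lu = λ₀u, and moreover Re z ≤ λ₀ for every z in the spectrum of L acting on complex L¹(Ω). -/
open MeasureTheory ENNReal Set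

section Abstract
set_option linter.unusedSectionVars false
variable {E : Type*} [NormedAddCommGroup E] [Lattice E] [HasSolidNorm E] [IsOrderedAddMonoid E]
  [NormedSpace ℝ E]

/-- Geometric growth bound of the powers of `T` on the positive cone. -/
def GrowthBd (φ : E →L[ℝ] ℝ) (T : E →L[ℝ] E) (ρ : ℝ) : Prop :=
  0 ≤ ρ ∧ ∃ C : ℝ, 0 ≤ C ∧ ∀ n : ℕ, ∀ f : E, 0 ≤ f → φ ((T ^ n) f) ≤ C * ρ ^ n * φ f

theorem pos_pow {T : E →L[ℝ] E} (hT : ∀ f, 0 ≤ f → 0 ≤ T f) (n : ℕ) :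
    ∀ f, 0 ≤ f → 0 ≤ (T ^ n) f := by
  induction n with
  | zero => intro f hf; simpa using hf
  | succ n ih => intro f hf; rw [pow_succ]; exact ih _ (hT f hf)

theorem growth_norm (φ : E →L[ℝ] ℝ) (hφ : ∀ f, 0 ≤ f → φ f = ‖f‖) (T : E →L[ℝ] E)
    (hT : ∀ f, 0 ≤ f → 0 ≤ T f) : GrowthBd φ T ‖T‖ := by
  refine ⟨norm_nonneg _, 1, zero_le_one, fun n f hf => ?_⟩
  rw [hφ _ (pos_pow hT n f hf), hφ f hf, one_mul]
  induction n with
  | zero => simp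
  | succ n ih =>
    rw [pow_succ', pow_succ', mul_assoc]
    exact (T.le_opNorm _).trans (mul_le_mul_of_nonneg_left ih (norm_nonneg _))

/-- A bound on the cone for a positive operator gives a norm bound. -/
theorem norm_le_of_cone (φ : E →L[ℝ] ℝ) (hφ : ∀ f, 0 ≤ f → φ f = ‖f‖) (S : E →L[ℝ] E)
    (hS : ∀ f, 0 ≤ f → 0 ≤ S f) (C : ℝ) (hC : 0 ≤ C) (h : ∀ f, 0 ≤ f → φ (S f) ≤ C * φ f) :
    ‖S‖ ≤ C := by
  refine S.opNorm_le_bound hC fun f => ?_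
  have h1 : |S f| ≤ S |f| := by
    refine abs_le'.2 ⟨?_, ?_⟩
    · have := hS (|f| - f) (sub_nonneg.2 (le_abs_self f))
      rwa [map_sub, sub_nonneg] at this
    · have := hS (|f| + f) (by have := neg_le_abs f; exact neg_le_iff_add_nonneg'.1 this |>.trans_eq (add_comm _ _))
      rw [map_add] at this
      exact neg_le_iff_add_nonneg.2 this
  have h2 : |S f| ≤ |S (|f|)| := h1.trans (le_abs_self _)
  have h3 := HasSolidNorm.solid h2
  have h4 := h |f| (abs_nonneg f)
  rw [hφ _ (hS _ (abs_nonneg f)), hφ _ (abs_nonneg f), norm_abs_eq_norm] at h4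
  exact h3.trans h4

/-- Openness of the set of growth bounds, quantitative. -/
theorem growth_open (φ : E →L[ℝ] ℝ) (hφ : ∀ f, 0 ≤ f → φ f = ‖f‖) (T : E →L[ℝ] E)
    (hT : ∀ f, 0 ≤ f → 0 ≤ T f) (s K : ℝ) (hs : 0 < s) (hK : 0 < K)
    (h : ∀ f, 0 ≤ f → ∀ N : ℕ, ∑ n ∈ Finset.range N, (s⁻¹) ^ (n + 1) * φ ((T ^ n) f) ≤ K * φ f) :
    GrowthBd φ T (max (s - 1 / K) 0) := by
  have hpos : ∀ f, 0 ≤ f → ∀ n, 0 ≤ (s⁻¹) ^ (n + 1) * φ ((T ^ n) f) := by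
    intro f hf n
    rw [hφ _ (pos_pow hT n f hf)]; positivity
  have hsum : ∀ f, 0 ≤ f → Summable (fun n => (s⁻¹) ^ (n + 1) * φ ((T ^ n) f)) := fun f hf =>
    summable_of_sum_range_le (hpos f hf) (h f hf)
  set p : E → ℝ := fun f => ∑' n, (s⁻¹) ^ (n + 1) * φ ((T ^ n) f) with hp
  have hpK : ∀ f, 0 ≤ f → p f ≤ K * φ f := fun f hf =>
    Real.tsum_le_of_sum_range_le (hpos f hf) (h f hf)
  have hp0 : ∀ f, 0 ≤ f → 0 ≤ p f := fun f hf => tsum_nonneg (hpos f hf)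
  have hps : ∀ f, 0 ≤ f → p f = s⁻¹ * φ f + s⁻¹ * p (T f) := by
    intro f hf
    simp only [hp]
    rw [(hsum f hf).tsum_eq_zero_add, ← tsum_mul_left]
    congr 1
    · simp
    · congr 1; ext n; rw [pow_succ T n]; simp only [mul_apply_eq_comp]; ring
  have hpl : ∀ f, 0 ≤ f → s⁻¹ * φ f ≤ p f := by
    intro f hf
    rw [hps f hf]
    have := hp0 (T f) (hT f hf)
    have : 0 ≤ s⁻¹ * p (T f) := by positivity
    linarith
  have hstep : ∀ f, 0 ≤ f → p (T f) ≤ max (s - 1 / K) 0 * p f := by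
    intro f hf
    have h1 := hps f hf
    have h2 : p (T f) = s * p f - φ f := by
      rw [h1]; field_simp; ring
    have h3 : 1 / K * p f ≤ φ f := by
      have := hpK f hf
      rw [one_div, inv_mul_le_iff₀ hK]; exact this
    have h4 : p (T f) ≤ (s - 1 / K) * p f := by rw [h2, sub_mul]; linarith
    exact h4.trans (mul_le_mul_of_nonneg_right (le_max_left _ _) (hp0 f hf))
  have hn : ∀ n : ℕ, ∀ f, 0 ≤ f → p ((T ^ n) f) ≤ (max (s - 1 / K) 0) ^ n * p f := by
    intro n
    induction n with
    | zero => intro f _; simp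
    | succ n ih =>
      intro f hf
      rw [pow_succ', pow_succ', mul_assoc]
      exact (hstep _ (pos_pow hT n f hf)).trans
        (mul_le_mul_of_nonneg_left (ih f hf) (le_max_right _ _))
  refine ⟨le_max_right _ _, s * K, by positivity, fun n f hf => ?_⟩
  have h1 := hpl _ (pos_pow hT n f hf)
  rw [inv_mul_le_iff₀ hs] at h1
  have hm : 0 ≤ (max (s - 1 / K) 0) ^ n := pow_nonneg (le_max_right _ _) _
  calc φ ((T ^ n) f) ≤ s * p ((T ^ n) f) := h1
    _ ≤ s * ((max (s - 1 / K) 0) ^ n * p f) := by gcongr; exact hn n f hf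
    _ ≤ s * ((max (s - 1 / K) 0) ^ n * (K * φ f)) := by gcongr; exact hpK f hf
    _ = _ := by ring

/-- Comparison of `T` with `A`, where `W (1 - A) = s - T`. -/
theorem growth_compare (φ : E →L[ℝ] ℝ) (hφ : ∀ f, 0 ≤ f → φ f = ‖f‖) (T A W : E →L[ℝ] E)
    (hT : ∀ f, 0 ≤ f → 0 ≤ T f) (hA : ∀ f, 0 ≤ f → 0 ≤ A f) (hW : ∀ f, 0 ≤ f → 0 ≤ W f)
    (s ρ : ℝ) (hρ : GrowthBd φ T ρ) (hs : ρ < s) (hWA : ∀ f, W f - W (A f) = s • f - T f) :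
    ∃ K : ℝ, 0 ≤ K ∧ ∀ n : ℕ, ‖A ^ n‖ ≤ K := by
  obtain ⟨hρ0, C, hC, hb⟩ := hρ
  have hs0 : 0 < s := hρ0.trans_lt hs
  have hsr : 0 < s - ρ := sub_pos.2 hs
  refine ⟨C / (s - ρ) * ‖W‖, by positivity, fun N => ?_⟩
  refine norm_le_of_cone φ hφ _ (pos_pow hA N) _ (by positivity) fun f hf => ?_
  set U : ℕ → E := fun N => ∑ n ∈ Finset.range N, (A ^ n) f with hU
  have hU0 : ∀ N, 0 ≤ U N := fun N => Finset.sum_nonneg fun n _ => pos_pow hA n f hf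
  have hWU : ∀ N, W (U N) - W (A (U N)) = W f - W ((A ^ N) f) := by
    intro N
    induction N with
    | zero => simp [hU]
    | succ N ih =>
      have : U (N + 1) = U N + (A ^ N) f := Finset.sum_range_succ _ _
      rw [this, map_add, map_add, map_add, pow_succ', mul_apply_eq_comp]
      rw [add_sub_add_comm, ih]; abel
  set V := U (N + 1) with hV
  have hphimono : ∀ x y : E, 0 ≤ y - x → φ x ≤ φ y := by
    intro x y hxy
    have := hφ _ hxy
    rw [map_sub] at this
    linarith [norm_nonneg (y - x)]
  have hq : ∀ k : ℕ, s * φ ((T ^ k) V) ≤ φ ((T ^ (k + 1)) V) + φ ((T ^ k) (W f)) := by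
    intro k
    have h1 : 0 ≤ T V + W f - s • V := by
      have e1 := hWU (N + 1)
      rw [← hV, hWA V] at e1
      have : T V + W f - s • V = W ((A ^ (N + 1)) f) := by
        have e2 : W ((A ^ (N + 1)) f) = W f - (s • V - T V) := by rw [e1]; abel
        rw [e2]; abel
      rw [this]
      exact hW _ (pos_pow hA _ f hf)
    have h2 := hφ _ (pos_pow hT k _ h1)
    have h3 : 0 ≤ φ ((T ^ k) (T V + W f - s • V)) := by rw [h2]; exact norm_nonneg _
    rw [map_sub, map_add, map_smul, map_sub, map_add, map_smul, smul_eq_mul] at h3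
    rw [pow_succ, mul_apply_eq_comp]
    linarith
  have hWf : φ (W f) ≤ ‖W‖ * φ f := by
    rw [hφ _ (hW f hf), hφ f hf]; exact W.le_opNorm f
  have hf0 : 0 ≤ φ f := by rw [hφ f hf]; exact norm_nonneg _
  have hWf0 : 0 ≤ φ (W f) := by rw [hφ _ (hW f hf)]; exact norm_nonneg _
  set η := φ (W f)
  have hx0 : 0 ≤ ρ / s := by positivity
  have hx1 : ρ / s < 1 := (div_lt_one hs0).2 hs
  have hk : ∀ k : ℕ, φ V ≤ (s⁻¹) ^ k * φ ((T ^ k) V) + C * η * s⁻¹ * ∑ j ∈ Finset.range k, (ρ / s) ^ j := by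
    intro k
    induction k with
    | zero => simp
    | succ k ih =>
      have h1 := hq k
      have h2 := hb k _ (hW f hf)
      have h3 : φ ((T ^ k) V) ≤ s⁻¹ * (φ ((T ^ (k + 1)) V) + C * ρ ^ k * η) := by
        rw [inv_mul_eq_div, le_div_iff₀ hs0]; linarith
      have h4 : (s⁻¹) ^ k * φ ((T ^ k) V) ≤ (s⁻¹) ^ k * (s⁻¹ * (φ ((T ^ (k + 1)) V) + C * ρ ^ k * η)) := by
        gcongr
      have h5 : (s⁻¹) ^ k * (s⁻¹ * (φ ((T ^ (k + 1)) V) + C * ρ ^ k * η)) =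
        (s⁻¹) ^ (k+1) * φ ((T ^ (k + 1)) V) + C * η * s⁻¹ * (ρ / s) ^ k := by
        rw [div_pow, div_eq_mul_inv, ← inv_pow]; ring
      rw [Finset.sum_range_succ, mul_add]
      linarith
  have hgs : ∀ k, ∑ j ∈ Finset.range k, (ρ / s) ^ j ≤ s / (s - ρ) := by
    intro k
    have := Summable.sum_le_tsum (Finset.range k) (fun j _ => pow_nonneg hx0 j) (summable_geometric_of_lt_one hx0 hx1)
    rw [tsum_geometric_of_lt_one hx0 hx1] at this
    refine this.trans_eq ?_
    field_simp
  have hk2 : ∀ k : ℕ, φ V ≤ C * φ V * (ρ / s) ^ k + C * η / (s - ρ) := by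
    intro k
    have h1 := hk k
    have h2 : (s⁻¹) ^ k * φ ((T ^ k) V) ≤ (s⁻¹) ^ k * (C * ρ ^ k * φ V) := by
      gcongr; exact hb k V (hU0 _)
    have h3 : (s⁻¹) ^ k * (C * ρ ^ k * φ V) = C * φ V * (ρ / s) ^ k := by
      rw [div_pow, div_eq_mul_inv, ← inv_pow]; ring
    have h4 : C * η * s⁻¹ * ∑ j ∈ Finset.range k, (ρ / s) ^ j ≤ C * η * s⁻¹ * (s / (s - ρ)) := by
      gcongr; exact hgs k
    have h5 : C * η * s⁻¹ * (s / (s - ρ)) = C * η / (s - ρ) := by field_simp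
    linarith
  have hlim : φ V ≤ C * η / (s - ρ) := by
    have ht := ((tendsto_pow_atTop_nhds_zero_of_lt_one hx0 hx1).const_mul (C * φ V)).add_const (C * η / (s - ρ))
    rw [mul_zero, zero_add] at ht
    exact ge_of_tendsto' ht hk2
  have hAV : φ ((A ^ N) f) ≤ φ V := by
    apply hphimono
    rw [hV, hU]
    simp only [Finset.sum_range_succ, add_sub_cancel_right]
    exact hU0 N
  calc φ ((A ^ N) f) ≤ C * η / (s - ρ) := hAV.trans hlim
    _ ≤ C * (‖W‖ * φ f) / (s - ρ) := by gcongr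
    _ = _ := by ring

/-- Approximate positive eigenvectors at the infimum of growth bounds. -/
theorem approx_eig (φ : E →L[ℝ] ℝ) (hφ : ∀ f, 0 ≤ f → φ f = ‖f‖)
    (hsm : ∀ (t : ℝ) (f : E), 0 ≤ t → 0 ≤ f → 0 ≤ t • f) (T : E →L[ℝ] E)
    (hT : ∀ f, 0 ≤ f → 0 ≤ T f) (r : ℝ) (hr : 0 < r) (hlow : ∀ ρ, GrowthBd φ T ρ → r ≤ ρ)
    (happ : ∀ s, r < s → ∃ ρ, ρ < s ∧ GrowthBd φ T ρ) (ε : ℝ) (hε : 0 < ε) :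
    ∃ u, 0 ≤ u ∧ φ u = 1 ∧ ‖r • u - T u‖ ≤ ε := by
  obtain ⟨s, K, hK, hrs, hKs, hKε⟩ : ∃ s K : ℝ, 0 < K ∧ r < s ∧ s - 1 / K < r ∧ 2 / K + (s - r) ≤ ε := by
    refine ⟨r + ε / 6, 3 / ε, by positivity, by linarith, ?_, ?_⟩
    · field_simp; linarith
    · field_simp; linarith
  have hs0 : 0 < s := hr.trans hrs
  obtain ⟨f, hf, N, hN⟩ : ∃ f, 0 ≤ f ∧ ∃ N : ℕ,
      K * φ f < ∑ n ∈ Finset.range N, (s⁻¹) ^ (n + 1) * φ ((T ^ n) f) := by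
    by_contra! hcon
    have := hlow _ (growth_open φ hφ T hT s K hs0 hK hcon)
    exact absurd this (not_le.2 (max_lt hKs hr))
  have hf0 : 0 < φ f := by
    have h0 : φ f = ‖f‖ := hφ f hf
    rcases (norm_nonneg f).lt_or_eq with h | h
    · rwa [h0]
    · rw [norm_eq_zero.1 h.symm] at hN; simp at hN
  obtain ⟨ρ, hρs, hρ0, C, hC, hb⟩ := happ s hrs
  have hx0 : 0 ≤ ρ / s := by positivity
  have hx1 : ρ / s < 1 := (div_lt_one hs0).2 hρs
  obtain ⟨N', hNN', hN'⟩ : ∃ N', N ≤ N' ∧ C * (ρ / s) ^ N' ≤ 1 := by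
    have ht := (tendsto_pow_atTop_nhds_zero_of_lt_one hx0 hx1).const_mul C
    rw [mul_zero] at ht
    obtain ⟨N', h1, h2⟩ := ((ht.eventually (ge_mem_nhds zero_lt_one)).and (Filter.eventually_ge_atTop N)).exists
    exact ⟨N', h2, h1⟩
  set u : ℕ → E := fun k => ∑ n ∈ Finset.range k, (s⁻¹) ^ (n + 1) • (T ^ n) f with hu
  have hu0 : ∀ k, 0 ≤ u k := fun k => Finset.sum_nonneg fun n _ =>
    hsm _ _ (by positivity) (pos_pow hT n f hf)
  have hφu : K * φ f < φ (u N') := by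
    refine hN.trans_le ?_
    simp only [hu, map_sum, map_smul, smul_eq_mul]
    refine Finset.sum_le_sum_of_subset_of_nonneg (Finset.range_mono hNN') fun n _ _ => ?_
    rw [hφ _ (pos_pow hT n f hf)]; positivity
  have hres : ∀ k, s • u k - T (u k) = f - (s⁻¹) ^ k • (T ^ k) f := by
    intro k
    induction k with
    | zero => simp [hu]
    | succ k ih =>
      have : u (k + 1) = u k + (s⁻¹) ^ (k + 1) • (T ^ k) f := Finset.sum_range_succ _ _
      rw [this, map_add, smul_add, map_smul, pow_succ' T k, mul_apply_eq_comp, smul_smul]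
      have e : s * s⁻¹ ^ (k + 1) = s⁻¹ ^ k := by rw [pow_succ]; field_simp
      rw [e]
      rw [add_sub_add_comm, ih]; abel
  have hrem : ‖(s⁻¹) ^ N' • (T ^ N') f‖ ≤ φ f := by
    rw [norm_smul, ← hφ _ (pos_pow hT _ f hf), Real.norm_of_nonneg (by positivity)]
    calc (s⁻¹) ^ N' * φ ((T ^ N') f) ≤ (s⁻¹) ^ N' * (C * ρ ^ N' * φ f) := by gcongr; exact hb _ f hf
      _ = (C * (ρ / s) ^ N') * φ f := by rw [div_pow, div_eq_mul_inv, ← inv_pow]; ring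
      _ ≤ 1 * φ f := by gcongr
      _ = φ f := one_mul _
  have hnorm : ‖s • u N' - T (u N')‖ ≤ 2 * φ f := by
    rw [hres]
    refine (norm_sub_le _ _).trans ?_
    rw [← hφ f hf]; linarith
  have hφu0 : 0 < φ (u N') := (by positivity : 0 < K * φ f).trans hφu
  refine ⟨(φ (u N'))⁻¹ • u N', hsm _ _ (by positivity) (hu0 _), ?_, ?_⟩
  · rw [map_smul, smul_eq_mul, inv_mul_cancel₀ hφu0.ne']
  · have e : r • (φ (u N'))⁻¹ • u N' - T ((φ (u N'))⁻¹ • u N')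
        = (φ (u N'))⁻¹ • ((s • u N' - T (u N')) - (s - r) • u N') := by
      rw [map_smul]; module
    rw [e, norm_smul, Real.norm_of_nonneg (by positivity), inv_mul_le_iff₀ hφu0]
    refine (norm_sub_le _ _).trans ?_
    rw [norm_smul, ← hφ _ (hu0 _), Real.norm_of_nonneg (by linarith)]
    have h1 : 2 * φ f ≤ 2 / K * φ (u N') := by
      rw [div_mul_eq_mul_div, le_div_iff₀ hK]; nlinarith
    nlinarith
end Abstract

section Hilbert
variable {H : Type*} [NormedAddCommGroup H] [InnerProductSpace ℝ H] [CompleteSpace H]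

/-- Cantor intersection for bounded closed convex sets in a Hilbert space. -/
theorem convex_inter (K : ℕ → Set H) (hanti : Antitone K) (hcl : ∀ n, IsClosed (K n))
    (hcv : ∀ n, Convex ℝ (K n)) (R : ℝ) (hne : ∀ n, ∃ x ∈ K n, ‖x‖ ≤ R) : ∃ x, ∀ n, x ∈ K n := by
  have hmin : ∀ n, ∃ v ∈ K n, ∀ w ∈ K n, ‖v‖ ≤ ‖w‖ := by
    intro n
    obtain ⟨v, hv, h⟩ := exists_norm_eq_iInf_of_complete_convex (let ⟨x, hx, _⟩ := hne n; ⟨x, hx⟩)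
      (hcl n).isComplete (hcv n) 0
    refine ⟨v, hv, fun w hw => ?_⟩
    simp only [zero_sub, norm_neg] at h
    rw [h]
    exact ciInf_le (f := fun w : K n => ‖(w : H)‖) ⟨0, by rintro _ ⟨y, rfl⟩; exact norm_nonneg _⟩ ⟨w, hw⟩
  choose x hx hxm using hmin
  have hmono : Monotone fun n => ‖x n‖ ^ 2 := fun n m hnm => by
    have := hxm n _ (hanti hnm (hx m))
    dsimp only
    gcongr
  have hbdd : BddAbove (range fun n => ‖x n‖ ^ 2) := by
    refine ⟨R ^ 2, ?_⟩
    rintro _ ⟨n, rfl⟩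
    obtain ⟨y, hy, hyR⟩ := hne n
    have := (hxm n y hy).trans hyR
    dsimp only
    gcongr
  have hconv := tendsto_atTop_ciSup hmono hbdd
  have hcs := hconv.cauchySeq
  have hkey : ∀ n m, n ≤ m → ‖x n - x m‖ ^ 2 ≤ 2 * (‖x m‖ ^ 2 - ‖x n‖ ^ 2) := by
    intro n m hnm
    have hp := parallelogram_law_with_norm ℝ (x n) (x m)
    have hmid : (1 / 2 : ℝ) • x n + (1 / 2 : ℝ) • x m ∈ K n :=
      hcv n (hx n) (hanti hnm (hx m)) (by norm_num) (by norm_num) (by norm_num)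
    have h1 := hxm n _ hmid
    rw [← smul_add, norm_smul, Real.norm_of_nonneg (by norm_num)] at h1
    nlinarith [norm_nonneg (x n), norm_nonneg (x n + x m)]
  have hc : CauchySeq x := by
    rw [Metric.cauchySeq_iff'] at hcs ⊢
    intro ε hε
    obtain ⟨N, hN⟩ := hcs (ε ^ 2 / 2) (by positivity)
    refine ⟨N, fun n hn => ?_⟩
    have h1 := hkey N n hn
    have h2 := hN n hn
    rw [Real.dist_eq] at h2
    have h3 := (le_abs_self _).trans_lt h2
    rw [dist_comm, dist_eq_norm]
    have : ‖x N - x n‖ ^ 2 < ε ^ 2 := by linarith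
    exact lt_of_pow_lt_pow_left₀ 2 hε.le this
  obtain ⟨y, hy⟩ := cauchySeq_tendsto_of_complete hc
  exact ⟨y, fun n => (hcl n).mem_of_tendsto hy
    ((Filter.eventually_ge_atTop n).mono fun m hm => hanti hm (hx m))⟩

/-- Extraction of an exact solution out of approximate ones factoring through a Hilbert space. -/
theorem extract {E : Type*} [NormedAddCommGroup E] [NormedSpace ℝ E]
    (ι : H →L[ℝ] E) (P : Set E) (hPc : IsClosed P) (hPv : Convex ℝ P) (φ : E →L[ℝ] ℝ)
    (D : E →L[ℝ] E) (R : ℝ)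
    (h : ∀ ε : ℝ, 0 < ε → ∃ w : H, ‖w‖ ≤ R ∧ ι w ∈ P ∧ |φ (ι w) - 1| ≤ ε ∧ ‖D (ι w)‖ ≤ ε) :
    ∃ v ∈ P, φ v = 1 ∧ D v = 0 := by
  set e : ℕ → ℝ := fun n => 1 / ((n : ℝ) + 1)
  have he : Antitone e := fun n m hnm => one_div_le_one_div_of_le (by positivity) (by gcongr)
  set K : ℕ → Set H := fun n => ι ⁻¹' P ∩ ((fun w => φ (ι w)) ⁻¹' Metric.closedBall 1 (e n) ∩
    (fun w => D (ι w)) ⁻¹' Metric.closedBall 0 (e n)) with hK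
  have hex : ∃ x, ∀ n, x ∈ K n := by
    refine convex_inter K ?_ ?_ ?_ R ?_
    · intro n m hnm x hx
      exact ⟨hx.1, Metric.closedBall_subset_closedBall (he hnm) hx.2.1,
        Metric.closedBall_subset_closedBall (he hnm) hx.2.2⟩
    · intro n
      exact (hPc.preimage ι.continuous).inter
        ((Metric.isClosed_closedBall.preimage (by fun_prop)).inter
          (Metric.isClosed_closedBall.preimage (by fun_prop)))
    · intro n
      refine (hPv.linear_preimage ι.toLinearMap).inter
        (((convex_closedBall (1 : ℝ) (e n)).linear_preimage (φ.comp ι).toLinearMap).inter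
          ((convex_closedBall (0 : E) (e n)).linear_preimage (D.comp ι).toLinearMap))
    · intro n
      obtain ⟨w, h1, h2, h3, h4⟩ := h (e n) (by positivity)
      exact ⟨w, ⟨h2, by simpa [Real.dist_eq] using h3, by simpa using h4⟩, h1⟩
  obtain ⟨w, hw⟩ := hex
  refine ⟨ι w, (hw 0).1, ?_, ?_⟩
  · have : |φ (ι w) - 1| ≤ 0 := ge_of_tendsto' tendsto_one_div_add_atTop_nhds_zero_nat fun n => by
      simpa [Real.dist_eq, e] using (hw n).2.1
    linarith [abs_eq_zero.1 (le_antisymm this (abs_nonneg _))]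
  · have : ‖D (ι w)‖ ≤ 0 := ge_of_tendsto' tendsto_one_div_add_atTop_nhds_zero_nat fun n => by
      simpa [e] using (hw n).2.2
    exact norm_le_zero_iff.1 this
end Hilbert

theorem le_of_pow_le_mul_pow {x ρ C : ℝ} (hρ : 0 ≤ ρ) (h : ∀ n : ℕ, x ^ n ≤ C * ρ ^ n) :
    x ≤ ρ := by
  by_contra! hx
  have hx0 : 0 < x := hρ.trans_lt hx
  have ht := (tendsto_pow_atTop_nhds_zero_of_lt_one (div_nonneg hρ hx0.le)
    ((div_lt_one hx0).2 hx)).const_mul C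
  rw [mul_zero] at ht
  have : (1 : ℝ) ≤ 0 := ge_of_tendsto' ht fun n => by
    rw [div_pow, ← mul_div_assoc, le_div_iff₀ (by positivity), one_mul]
    exact h n
  linarith

theorem spec_bound {𝕜 A : Type*} [NormedField 𝕜] [NormedRing A] [NormedAlgebra 𝕜 A]
    [CompleteSpace A] (b : A) (C ρ : ℝ) (hρ : 0 ≤ ρ) (h : ∀ n : ℕ, ‖b ^ n‖ ≤ C * ρ ^ n)
    (k : 𝕜) (hk : k ∈ spectrum 𝕜 b) : ‖k‖ ≤ ρ := by
  refine le_of_pow_le_mul_pow (C := C * ‖(1 : A)‖) hρ fun n => ?_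
  have h1 := spectrum.norm_le_norm_mul_of_mem (spectrum.pow_mem_pow b n hk)
  rw [norm_pow] at h1
  calc ‖k‖ ^ n ≤ ‖b ^ n‖ * ‖(1 : A)‖ := h1
    _ ≤ C * ρ ^ n * ‖(1 : A)‖ := by gcongr; exact h n
    _ = _ := by ring

theorem phi_eq {α : Type*} {m : MeasurableSpace α} {μ : Measure α} (f : Lp ℝ 1 μ) (hf : 0 ≤ f) :
    (L1.integralCLM : (Lp ℝ 1 μ) →L[ℝ] ℝ) f = ‖f‖ := by
  rw [← L1.integral_eq, L1.integral_eq_integral, L1.norm_eq_integral_norm]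
  refine integral_congr_ae ?_
  filter_upwards [(Lp.coeFn_nonneg f).2 hf] with x hx
  exact (Real.norm_of_nonneg hx).symm

theorem phi_int {α : Type*} {m : MeasurableSpace α} {μ : Measure α} (f : Lp ℝ 1 μ) :
    (L1.integralCLM : (Lp ℝ 1 μ) →L[ℝ] ℝ) f = ∫ x, f x ∂μ := by
  rw [← L1.integral_eq, L1.integral_eq_integral]

theorem lp_smul_nonneg {α : Type*} {m : MeasurableSpace α} {μ : Measure α} (t : ℝ) (f : Lp ℝ 1 μ)
    (ht : 0 ≤ t) (hf : 0 ≤ f) : 0 ≤ t • f := by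
  rw [← Lp.coeFn_nonneg] at hf ⊢
  filter_upwards [hf, Lp.coeFn_smul t f] with x hx h
  rw [h]
  exact mul_nonneg ht hx

/-- The pointwise norm as an element of real `L¹`. -/
noncomputable def absLp {α : Type*} {m : MeasurableSpace α} {μ : Measure α} (f : Lp ℂ 1 μ) :
    Lp ℝ 1 μ := (Lp.memLp f).norm.toLp

theorem absLp_coe {α : Type*} {m : MeasurableSpace α} {μ : Measure α} (f : Lp ℂ 1 μ) :
    absLp f =ᵐ[μ] fun x => ‖f x‖ := MemLp.coeFn_toLp _

theorem absLp_norm {α : Type*} {m : MeasurableSpace α} {μ : Measure α} (f : Lp ℂ 1 μ) :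
    ‖absLp f‖ = ‖f‖ := by
  rw [absLp, Lp.norm_toLp, Lp.norm_def, eLpNorm_norm]

theorem absLp_nonneg {α : Type*} {m : MeasurableSpace α} {μ : Measure α} (f : Lp ℂ 1 μ) :
    0 ≤ absLp f := by
  rw [← Lp.coeFn_nonneg]
  filter_upwards [absLp_coe f] with x hx
  rw [hx]; exact norm_nonneg _

/-- Weak compactness of order intervals, in the form needed: approximate fixed points in an order
interval `[0, G]` of `L¹` give a genuine one. -/
theorem extract_L1 {α : Type*} {m : MeasurableSpace α} {μ : Measure α} (G : α → ℝ)
    (hG : Integrable G μ) (hG0 : ∀ x, 0 ≤ G x) (φ : Lp ℝ 1 μ →L[ℝ] ℝ)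
    (D : Lp ℝ 1 μ →L[ℝ] Lp ℝ 1 μ)
    (h : ∀ ε : ℝ, 0 < ε → ∃ v : Lp ℝ 1 μ, 0 ≤ v ∧ (∀ᵐ x ∂μ, v x ≤ G x) ∧
      |φ v - 1| ≤ ε ∧ ‖D v‖ ≤ ε) :
    ∃ v, 0 ≤ v ∧ φ v = 1 ∧ D v = 0 := by
  have hm : MemLp (fun x => √(G x)) 2 μ := by
    rw [memLp_two_iff_integrable_sq (Real.continuous_sqrt.comp_aestronglyMeasurable hG.1)]
    exact hG.congr (Filter.Eventually.of_forall fun x => (Real.sq_sqrt (hG0 x)).symm)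
  set q : Lp ℝ 2 μ := hm.toLp with hq
  have hqc : q =ᵐ[μ] fun x => √(G x) := hm.coeFn_toLp
  have hcv : Convex ℝ (Ici (0 : Lp ℝ 1 μ)) := by
    intro x hx y hy s t hs ht _
    exact add_nonneg (lp_smul_nonneg s x hs hx) (lp_smul_nonneg t y ht hy)
  refine extract ((ContinuousLinearMap.mul ℝ ℝ).holderL μ 2 2 1 q) (Ici 0) isClosed_Ici hcv φ D
    ‖q‖ fun ε hε => ?_
  obtain ⟨v, hv0, hvG, h1, h2⟩ := h ε hε
  have hv0' := (Lp.coeFn_nonneg v).2 hv0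
  have hle : ∀ᵐ x ∂μ, ‖v x / √(G x)‖ ≤ ‖√(G x)‖ := by
    filter_upwards [hv0', hvG] with x hx0 hx
    rw [Real.norm_of_nonneg (div_nonneg hx0 (Real.sqrt_nonneg _)),
      Real.norm_of_nonneg (Real.sqrt_nonneg _)]
    refine div_le_of_le_mul₀ (Real.sqrt_nonneg _) (Real.sqrt_nonneg _) ?_
    rw [Real.mul_self_sqrt (hG0 x)]; exact hx
  have hmw : MemLp (fun x => v x / √(G x)) 2 μ := by
    refine hm.mono ?_ hle
    exact ((Lp.aestronglyMeasurable v).aemeasurable.div hm.1.aemeasurable).aestronglyMeasurable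
  have hιw : (ContinuousLinearMap.mul ℝ ℝ).holderL μ 2 2 1 q hmw.toLp = v := by
    refine Lp.ext ?_
    have := ContinuousLinearMap.coeFn_holder (r := 1) (ContinuousLinearMap.mul ℝ ℝ) q hmw.toLp
    rw [ContinuousLinearMap.holderL_apply_apply]
    filter_upwards [this, hqc, hmw.coeFn_toLp, hv0', hvG] with x e1 e2 e3 hx0 hx
    rw [e1, e2, e3, ContinuousLinearMap.mul_apply']
    by_cases hz : √(G x) = 0
    · have : G x = 0 := by rwa [Real.sqrt_eq_zero (hG0 x)] at hz
      rw [this] at hx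
      rw [hz, zero_mul]; exact le_antisymm hx0 hx
    · exact mul_div_cancel₀ _ hz
  refine ⟨hmw.toLp, ?_, ?_, ?_, ?_⟩
  · refine Lp.norm_le_norm_of_ae_le ?_
    filter_upwards [hle, hqc, hmw.coeFn_toLp] with x h1 h2 h3
    rw [h2, h3]; exact h1
  · rw [hιw]; exact hv0
  · rw [hιw]; exact h1
  · rw [hιw]; exact h2

/-- If J(x,y) ≤ g(x) for a.e. (x,y) ∈ Ω × Ω with g ∈ L¹(Ω), and
lim_{λ→(−inf a)⁺} spr(A_λ) > 1, then L has a principal eigenvalue λ₀ > −inf a with a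
nonzero nonnegative eigenfunction in L¹(Ω), and Re z ≤ λ₀ for every z in the spectrum
of L on complex L¹(Ω). -/
theorem stmt_1
    (Ω : Set ℝ) (hΩ : MeasurableSet Ω)
    (a : ℝ → ℝ) (ha : Continuous a)
    (c c' : ℝ) (hc0 : 0 < c) (hcc' : c < c')
    (hbound : ∀ x ∈ Ω, c < a x ∧ a x < c')
    (J : ℝ → ℝ → ℝ) (hJmeas : Measurable (Function.uncurry J))
    (hJnonneg : ∀ x y, 0 ≤ J x y)
    -- there is g ∈ L¹(Ω) with J(x,y) ≤ g(x) for a.e. (x,y) ∈ Ω × Ω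
    (g : ℝ → ℝ) (hg : Integrable g (volume.restrict Ω))
    (hJg : ∀ᵐ p ∂((volume.restrict Ω).prod (volume.restrict Ω)),
      J p.1 p.2 ≤ g p.1)
    -- 𝒥 is a bounded operator on L¹(Ω) given by the integral kernel J,
    -- with nonzero spectral radius
    (𝒥 : Lp ℝ 1 (volume.restrict Ω) →L[ℝ] Lp ℝ 1 (volume.restrict Ω))
    (h𝒥 : ∀ u : Lp ℝ 1 (volume.restrict Ω),
      ⇑(𝒥 u) =ᵐ[volume.restrict Ω] fun x => ∫ y in Ω, J x y * u y)
    (h𝒥spr : spectralRadius ℝ 𝒥 ≠ 0)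
    -- the operator L on real L¹(Ω)
    (L : Lp ℝ 1 (volume.restrict Ω) →L[ℝ] Lp ℝ 1 (volume.restrict Ω))
    (hL : ∀ u : Lp ℝ 1 (volume.restrict Ω),
      ⇑(L u) =ᵐ[volume.restrict Ω] fun x => (𝒥 u) x - a x * u x)
    -- the operator L acting on complex L¹(Ω)
    (Lc : Lp ℂ 1 (volume.restrict Ω) →L[ℂ] Lp ℂ 1 (volume.restrict Ω))
    (hLc : ∀ u : Lp ℂ 1 (volume.restrict Ω),
      ⇑(Lc u) =ᵐ[volume.restrict Ω]
        fun x => (∫ y in Ω, (J x y : ℂ) * u y) - (a x : ℂ) * u x)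
    -- the family A_λ
    (A : ℝ → (Lp ℝ 1 (volume.restrict Ω) →L[ℝ] Lp ℝ 1 (volume.restrict Ω)))
    (hA : ∀ l : ℝ, -sInf (a '' Ω) < l → ∀ u : Lp ℝ 1 (volume.restrict Ω),
      ⇑(A l u) =ᵐ[volume.restrict Ω] fun x => (𝒥 u) x / (l + a x))
    -- lim_{λ → (−inf a)⁺} spr(A_λ) > 1
    (hlim : ∃ S : ℝ≥0∞, 1 < S ∧
      Filter.Tendsto (fun l => spectralRadius ℝ (A l))
        (nhdsWithin (-sInf (a '' Ω)) (Set.Ioi (-sInf (a '' Ω)))) (nhds S)) :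
    ∃ lam0 : ℝ, -sInf (a '' Ω) < lam0 ∧
      (∃ u : Lp ℝ 1 (volume.restrict Ω), u ≠ 0 ∧
        ((0 : ℝ → ℝ) ≤ᵐ[volume.restrict Ω] ⇑u) ∧ L u = lam0 • u) ∧
      ∀ z ∈ spectrum ℂ Lc, z.re ≤ lam0 := by
  set m0 : ℝ := sInf (a '' Ω) with hm0
  have hΩae : ∀ᵐ x ∂(volume.restrict Ω), x ∈ Ω := ae_restrict_mem hΩ
  have hinf : ∀ x ∈ Ω, m0 ≤ a x := fun x hx =>
    csInf_le ⟨c, by rintro _ ⟨y, hy, rfl⟩; exact (hbound y hy).1.le⟩ ⟨x, hx, rfl⟩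
  have hm0c : m0 ≤ c' := by
    rcases Ω.eq_empty_or_nonempty with h | ⟨x, hx⟩
    · rw [hm0, h]; simp; linarith
    · exact (hinf x hx).trans (hbound x hx).2.le
  set φ : Lp ℝ 1 (volume.restrict Ω) →L[ℝ] ℝ := L1.integralCLM with hφdef
  have hφ : ∀ f : Lp ℝ 1 (volume.restrict Ω), 0 ≤ f → φ f = ‖f‖ := phi_eq
  -- positivity
  have h𝒥pos : ∀ f : Lp ℝ 1 (volume.restrict Ω), 0 ≤ f → 0 ≤ 𝒥 f := by
    intro f hf
    rw [← Lp.coeFn_nonneg] at hf ⊢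
    filter_upwards [h𝒥 f] with x hx
    rw [hx]
    refine integral_nonneg_of_ae ?_
    filter_upwards [hf] with y hy
    exact mul_nonneg (hJnonneg x y) hy
  set T : Lp ℝ 1 (volume.restrict Ω) →L[ℝ] Lp ℝ 1 (volume.restrict Ω) := L + c' • ContinuousLinearMap.id ℝ _ with hTdef
  have hTapp : ∀ f, T f = L f + c' • f := fun f => rfl
  have hTae : ∀ f : Lp ℝ 1 (volume.restrict Ω), T f =ᵐ[(volume.restrict Ω)] fun x => 𝒥 f x + (c' - a x) * f x := by
    intro f
    rw [hTapp]
    filter_upwards [Lp.coeFn_add (L f) (c' • f), Lp.coeFn_smul c' f, hL f] with x h1 h2 h3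
    rw [h1, Pi.add_apply, h2, h3, Pi.smul_apply, smul_eq_mul]; ring
  have hTpos : ∀ f : Lp ℝ 1 (volume.restrict Ω), 0 ≤ f → 0 ≤ T f := by
    intro f hf
    have h1 := h𝒥pos f hf
    rw [← Lp.coeFn_nonneg] at hf h1 ⊢
    filter_upwards [hTae f, hf, h1, hΩae] with x e1 e2 e3 e4
    rw [e1]
    exact add_nonneg e3 (mul_nonneg (by linarith [(hbound x e4).2]) e2)
  have hApos : ∀ l, -m0 < l → ∀ f : Lp ℝ 1 (volume.restrict Ω), 0 ≤ f → 0 ≤ A l f := by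
    intro l hl f hf
    have h1 := h𝒥pos f hf
    rw [← Lp.coeFn_nonneg] at hf h1 ⊢
    filter_upwards [hA l hl f, h1, hΩae] with x e1 e2 e3
    rw [e1]
    exact div_nonneg e2 (by linarith [hinf x e3])
  set W : ℝ → Lp ℝ 1 (volume.restrict Ω) →L[ℝ] Lp ℝ 1 (volume.restrict Ω) := fun l => l • ContinuousLinearMap.id ℝ _ + (𝒥 - L) with hW
  have hWapp : ∀ l f, W l f = l • f + (𝒥 f - L f) := fun l f => rfl
  have hWae : ∀ l, ∀ f : Lp ℝ 1 (volume.restrict Ω), W l f =ᵐ[(volume.restrict Ω)] fun x => (l + a x) * f x := by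
    intro l f
    rw [hWapp]
    filter_upwards [Lp.coeFn_add (l • f) (𝒥 f - L f), Lp.coeFn_smul l f,
      Lp.coeFn_sub (𝒥 f) (L f), hL f] with x h1 h2 h3 h4
    rw [h1, Pi.add_apply, h2, h3, Pi.smul_apply, smul_eq_mul, Pi.sub_apply, h4]; ring
  have hWpos : ∀ l, -m0 < l → ∀ f : Lp ℝ 1 (volume.restrict Ω), 0 ≤ f → 0 ≤ W l f := by
    intro l hl f hf
    rw [← Lp.coeFn_nonneg] at hf ⊢
    filter_upwards [hWae l f, hf, hΩae] with x e1 e2 e3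
    rw [e1]
    exact mul_nonneg (by linarith [hinf x e3]) e2
  have hWA : ∀ l, -m0 < l → ∀ f, W l f - W l (A l f) = (l + c') • f - T f := by
    intro l hl f
    have h1 : W l (A l f) = 𝒥 f := by
      refine Lp.ext ?_
      filter_upwards [hWae l (A l f), hA l hl f, hΩae] with x e1 e2 e3
      rw [e1, e2]
      have : l + a x ≠ 0 := by have := hinf x e3; intro h; linarith
      field_simp
    rw [h1, hWapp, hTapp]
    module
  -- the growth rate
  set Gs : Set ℝ := {ρ | GrowthBd φ T ρ} with hGs
  set r : ℝ := sInf Gs with hr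
  have hGbdd : BddBelow Gs := ⟨0, fun ρ h => h.1⟩
  have hGne : Gs.Nonempty := ⟨_, growth_norm φ hφ T hTpos⟩
  have hlow : ∀ ρ, GrowthBd φ T ρ → r ≤ ρ := fun ρ h => csInf_le hGbdd h
  have happ : ∀ s, r < s → ∃ ρ, ρ < s ∧ GrowthBd φ T ρ := by
    intro s hs
    obtain ⟨ρ, h1, h2⟩ := exists_lt_of_csInf_lt hGne hs
    exact ⟨ρ, h2, h1⟩
  have hrm : c' - m0 < r := by
    by_contra! hcon
    obtain ⟨S, hS1, hS⟩ := hlim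
    obtain ⟨l, hl1, hl2⟩ := ((hS.eventually (lt_mem_nhds hS1)).and self_mem_nhdsWithin).exists
    have hl : -m0 < l := hl2
    obtain ⟨ρ, hρ1, hρ2⟩ := happ (l + c') (by linarith)
    obtain ⟨K, hK0, hK⟩ := growth_compare φ hφ T (A l) (W l) hTpos (hApos l hl) (hWpos l hl) (l + c') ρ
      hρ2 hρ1 (hWA l hl)
    refine absurd hl1 (not_lt.2 ?_)
    refine iSup₂_le fun k hk => ?_
    have := spec_bound (A l) K 1 zero_le_one (fun n => by simpa using hK n) k hk
    rw [← ENNReal.coe_one, ENNReal.coe_le_coe]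
    exact this
  have hr0 : 0 < r := by linarith
  have hlam : -m0 < r - c' := by linarith
  refine ⟨r - c', hlam, ?_, ?_⟩
  · -- the eigenvector
    set lam : ℝ := r - c' with hlamdef
    set κ : ℝ := lam + m0 with hκ
    have hκ0 : 0 < κ := by linarith
    obtain ⟨v, hv0, hv1, hvD⟩ := extract_L1 (fun x => max (g x) 0 / κ)
      (hg.pos_part.div_const κ) (fun x => by positivity) φ
      (A lam - ContinuousLinearMap.id ℝ _) (by
        intro ε hε
        set δ : ℝ := ε * κ / (‖φ‖ + ‖A lam‖ + 1) with hδ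
        have hden : 0 < ‖φ‖ + ‖A lam‖ + 1 := by positivity
        have hδ0 : 0 < δ := by positivity
        obtain ⟨u, hu0, hu1, hur⟩ := approx_eig φ hφ lp_smul_nonneg T hTpos r hr0 hlow happ δ hδ0
        have hu0' := (Lp.coeFn_nonneg u).2 hu0
        have hdiff : ‖A lam u - u‖ ≤ δ / κ := by
          have h1 : ‖A lam u - u‖ ≤ κ⁻¹ * ‖r • u - T u‖ := by
            refine Lp.norm_le_mul_norm_of_ae_le_mul ?_
            filter_upwards [Lp.coeFn_sub (A lam u) u, hA lam hlam u, Lp.coeFn_sub (r • u) (T u),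
              Lp.coeFn_smul r u, hTae u, hΩae] with x e1 e2 e3 e4 e5 e6
            have hpos : κ ≤ lam + a x := by linarith [hinf x e6]
            have hpos' : 0 < lam + a x := by linarith
            rw [e1, e3, Pi.sub_apply, Pi.sub_apply, e2, e4, e5, Pi.smul_apply, smul_eq_mul]
            have e : 𝒥 u x / (lam + a x) - u x
                = -((lam + a x)⁻¹ * (r * u x - (𝒥 u x + (c' - a x) * u x))) := by
              field_simp
              rw [hlamdef]; ring
            rw [e, norm_neg, norm_mul, Real.norm_of_nonneg (by positivity)]
            gcongr
          calc _ ≤ κ⁻¹ * ‖r • u - T u‖ := h1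
            _ ≤ κ⁻¹ * δ := by gcongr
            _ = δ / κ := by ring
        have hfin : (‖φ‖ + ‖A lam‖ + 1) * (δ / κ) = ε := by
          rw [hδ]; field_simp
        have hd0 : 0 ≤ δ / κ := by positivity
        have hφn := norm_nonneg φ
        have hAn := norm_nonneg (A lam)
        refine ⟨A lam u, hApos lam hlam u hu0, ?_, ?_, ?_⟩
        · filter_upwards [hA lam hlam u, h𝒥 u, hΩae, Measure.ae_ae_of_ae_prod hJg]
            with x e1 e2 e3 e4
          have hpos : κ ≤ lam + a x := by linarith [hinf x e3]
          have h1 : 𝒥 u x ≤ g x := by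
            rw [e2]
            calc ∫ y, J x y * u y ∂(volume.restrict Ω) ≤ ∫ y, g x * u y ∂(volume.restrict Ω) := by
                  refine integral_mono_of_nonneg ?_ ((L1.integrable_coeFn u).const_mul _) ?_
                  · filter_upwards [hu0'] with y hy
                    exact mul_nonneg (hJnonneg x y) hy
                  · filter_upwards [hu0', e4] with y hy hy2
                    exact mul_le_mul_of_nonneg_right hy2 hy
              _ = g x := by
                  rw [integral_const_mul, ← phi_int, ← hφdef, hu1, mul_one]
          rw [e1]
          exact div_le_div₀ (le_max_right _ _) (h1.trans (le_max_left _ _)) hκ0 hpos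
        · have : φ (A lam u) - 1 = φ (A lam u - u) := by rw [map_sub, hu1]
          rw [this, ← Real.norm_eq_abs]
          refine (φ.le_opNorm _).trans ?_
          have := mul_le_mul_of_nonneg_left hdiff hφn
          nlinarith
        · have : (A lam - ContinuousLinearMap.id ℝ (Lp ℝ 1 (volume.restrict Ω))) (A lam u) = A lam (A lam u - u) := by
            rw [map_sub]; rfl
          rw [this]
          refine ((A lam).le_opNorm _).trans ?_
          have := mul_le_mul_of_nonneg_left hdiff hAn
          nlinarith)
    refine ⟨v, ?_, (Lp.coeFn_nonneg v).2 hv0, ?_⟩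
    · rintro rfl
      simp at hv1
    · have h1 : A lam v = v := sub_eq_zero.1 hvD
      have h2 := hWA lam hlam v
      rw [h1, sub_self, hTapp] at h2
      have h3 : lam • v - L v = 0 := by rw [h2]; module
      exact (sub_eq_zero.1 h3).symm
  · -- the spectral bound
    intro z hz
    set Tc : Lp ℂ 1 (volume.restrict Ω) →L[ℂ] Lp ℂ 1 (volume.restrict Ω) := algebraMap ℂ _ (c' : ℂ) + Lc with hTc
    have hTcapp : ∀ f, Tc f = (c' : ℂ) • f + Lc f := fun f => rfl
    have hzT : z + c' ∈ spectrum ℂ Tc := spectrum.add_mem_add_iff.2 hz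
    have hTmono : ∀ f g : Lp ℝ 1 (volume.restrict Ω), f ≤ g → T f ≤ T g := by
      intro f g hfg
      have := hTpos (g - f) (sub_nonneg.2 hfg)
      rwa [map_sub, sub_nonneg] at this
    have hdom1 : ∀ f, absLp (Tc f) ≤ T (absLp f) := by
      intro f
      rw [← Lp.coeFn_le]
      filter_upwards [absLp_coe (Tc f), hTae (absLp f), h𝒥 (absLp f), absLp_coe f, hLc f,
        Lp.coeFn_add ((c' : ℂ) • f) (Lc f), Lp.coeFn_smul (c' : ℂ) f, hΩae]
        with x e1 e2 e3 e4 e5 e6 e7 e8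
      rw [e1, e2, e3, e4, hTcapp, e6, Pi.add_apply, e7, e5, Pi.smul_apply, smul_eq_mul]
      have h1 : (c' : ℂ) * f x + ((∫ y, (J x y : ℂ) * f y ∂(volume.restrict Ω)) - (a x : ℂ) * f x)
          = (∫ y, (J x y : ℂ) * f y ∂(volume.restrict Ω)) + ((c' - a x : ℝ) : ℂ) * f x := by push_cast; ring
      rw [h1]
      refine (norm_add_le _ _).trans (add_le_add ?_ ?_)
      · refine (norm_integral_le_integral_norm _).trans_eq ?_
        refine integral_congr_ae ?_
        filter_upwards [absLp_coe f] with y hy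
        rw [hy, norm_mul, Complex.norm_real, Real.norm_of_nonneg (hJnonneg x y)]
      · rw [norm_mul, Complex.norm_real, Real.norm_of_nonneg (by linarith [(hbound x e8).2])]
    have hdom : ∀ n : ℕ, ∀ f, absLp ((Tc ^ n) f) ≤ (T ^ n) (absLp f) := by
      intro n
      induction n with
      | zero => intro f; exact le_rfl
      | succ n ih =>
        intro f
        rw [pow_succ', pow_succ']
        exact (hdom1 _).trans (hTmono _ _ (ih f))
    have hall : ∀ ρ, GrowthBd φ T ρ → ‖z + c'‖ ≤ ρ := by
      rintro ρ ⟨hρ0, C, hC, hb⟩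
      refine spec_bound Tc C ρ hρ0 (fun n => ?_) _ hzT
      refine ContinuousLinearMap.opNorm_le_bound _ (by positivity) fun f => ?_
      have h1 := hb n _ (absLp_nonneg f)
      rw [hφ _ (pos_pow hTpos n _ (absLp_nonneg f)), hφ _ (absLp_nonneg f), absLp_norm] at h1
      refine le_trans ?_ h1
      rw [← absLp_norm]
      refine HasSolidNorm.solid ?_
      rw [abs_of_nonneg (absLp_nonneg _), abs_of_nonneg (pos_pow hTpos n _ (absLp_nonneg f))]
      exact hdom n f
    have hzr : ‖z + c'‖ ≤ r := le_csInf hGne hall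
    have := (Complex.re_le_norm (z + c')).trans hzr
    rw [Complex.add_re, Complex.ofReal_re] at this
    linarith
end

section
/- Suppose there exists g ∈ L¹(Ω) such that J(x,y) ≤ g(x) for almost every (x,y) ∈ Ω × Ω, and that 𝒥 is a bounded operator on L¹(Ω) with nonzero spectral radius. Then for every λ > −inf a, the operator A_λ on L¹(Ω) has a positive eigenvalue equal to its spectral radius with a nonnegative eigenfunction: there exists a nonzero u ∈ L¹(Ω) with u ≥ 0 a.e. such that A_λ u = r u, where r = spr(A_λ) > 0. -/
open MeasureTheory ENNReal Set

set_option linter.unusedSectionVars false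
set_option linter.unusedVariables false

section KR

variable {E : Type*} [NormedAddCommGroup E] [Lattice E] [HasSolidNorm E] [IsOrderedAddMonoid E]
  [NormedSpace ℝ E] [OrderClosedTopology E]

/-- positivity of a bounded operator -/
def KRPos (T : E →L[ℝ] E) : Prop := ∀ u : E, 0 ≤ u → 0 ≤ T u

theorem KRPos.mono {T : E →L[ℝ] E} (hT : KRPos T) {u v : E} (h : u ≤ v) : T u ≤ T v := by
  have := hT (v - u) (sub_nonneg.2 h)
  rw [map_sub] at this
  exact sub_nonneg.1 this

theorem KRPos.abs_le {T : E →L[ℝ] E} (hT : KRPos T) (u : E) : |T u| ≤ T |u| := by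
  refine abs_le'.2 ⟨hT.mono (le_abs_self u), ?_⟩
  rw [← map_neg]
  exact hT.mono (neg_le_abs u)

theorem kr_norm_le_of_nonneg {x y : E} (hx : 0 ≤ x) (h : x ≤ y) : ‖x‖ ≤ ‖y‖ := by
  apply norm_le_norm_of_abs_le_abs
  rwa [abs_of_nonneg hx, abs_of_nonneg (hx.trans h)]

theorem KRPos.opNorm_le {T : E →L[ℝ] E} (hT : KRPos T) {C : ℝ} (hC : 0 ≤ C)
    (h : ∀ u, 0 ≤ u → ‖T u‖ ≤ C * ‖u‖) : ‖T‖ ≤ C := by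
  refine T.opNorm_le_bound hC fun u => ?_
  calc ‖T u‖ = ‖|T u|‖ := (norm_abs_eq_norm _).symm
    _ ≤ ‖T |u|‖ := kr_norm_le_of_nonneg (abs_nonneg _) (hT.abs_le u)
    _ ≤ C * ‖|u|‖ := h _ (abs_nonneg u)
    _ = C * ‖u‖ := by rw [norm_abs_eq_norm]

theorem KRPos.pow {T : E →L[ℝ] E} (hT : KRPos T) (n : ℕ) : KRPos (T ^ n) := by
  induction n with
  | zero => intro u hu; simpa using hu
  | succ n ih => intro u hu; rw [pow_succ]; exact ih _ (hT u hu)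

theorem KRPos.geom [CompleteSpace E] {X : E →L[ℝ] E} (hX : KRPos X) (h : ‖X‖ < 1) :
    ∃ Y : E →L[ℝ] E, KRPos Y ∧ Y * (1 - X) = 1 ∧ (1 - X) * Y = 1 := by
  refine ⟨∑' i : ℕ, X ^ i, ?_, geom_series_mul_neg X h, mul_neg_geom_series X h⟩
  intro u hu
  have hs : HasSum (fun i : ℕ => X ^ i) (∑' i : ℕ, X ^ i) :=
    (summable_geometric_of_norm_lt_one h).hasSum
  have h2 := hs.mapL (ContinuousLinearMap.apply ℝ E u)
  have h3 : Filter.Tendsto (fun s : Finset ℕ => ∑ i ∈ s, (X ^ i) u) Filter.atTop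
    (nhds ((∑' i : ℕ, X ^ i) u)) := h2
  refine ge_of_tendsto' h3 fun s => Finset.sum_nonneg fun i _ => hX.pow i u hu

/-- `t` has a positive resolvent -/
def KRG (T : E →L[ℝ] E) (t : ℝ) : Prop :=
  0 < t ∧ ∃ R : E →L[ℝ] E, KRPos R ∧ R * (t • 1 - T) = 1 ∧ (t • 1 - T) * R = 1

theorem KRG.pow_le (hsm : ∀ c : ℝ, 0 ≤ c → ∀ u : E, 0 ≤ u → 0 ≤ c • u)
    {T : E →L[ℝ] E} (hT : KRPos T) {t : ℝ} (h : KRG T t) :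
    ∃ C : ℝ, 0 ≤ C ∧ ∀ n : ℕ, ‖T ^ n‖ ≤ C * t ^ n := by
  obtain ⟨ht, R, hR, h1, h2⟩ := h
  have hRT : R * T = T * R := by
    have e1 : t • R - R * T = 1 := by rw [← h1, mul_sub, mul_smul_comm, mul_one]
    have e2 : t • R - T * R = 1 := by rw [← h2, sub_mul, smul_mul_assoc, one_mul]
    exact sub_right_injective (e1.trans e2.symm)
  -- T R u ≤ t R u
  have h3 : ∀ u, 0 ≤ u → ∀ n : ℕ, (T ^ n) (R u) ≤ t ^ n • R u := by
    intro u hu n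
    induction n with
    | zero => simp
    | succ n ih =>
      have e : T (R u) = t • R u - u := by
        have := congrArg (fun S : E →L[ℝ] E => S u) h2
        simp only [mul_apply_eq_comp, sub_apply,
          smul_apply, one_apply_eq_self] at this
        rw [eq_sub_iff_add_eq, add_comm, ← eq_sub_iff_add_eq, this]
      have e3 : T (R u) ≤ t • R u := by rw [e]; exact sub_le_self _ hu
      have e4 : t ^ n • (t • R u - T (R u)) ≥ 0 :=
        hsm _ (pow_nonneg ht.le n) _ (sub_nonneg.2 e3)
      calc (T ^ (n+1)) (R u) = T ((T ^ n) (R u)) := by rw [pow_succ']; rfl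
        _ ≤ T (t ^ n • R u) := hT.mono ih
        _ = t ^ n • T (R u) := by rw [map_smul]
        _ ≤ t ^ n • (t • R u) := by rw [smul_sub] at e4; exact sub_nonneg.1 e4
        _ = t ^ (n+1) • R u := by rw [smul_smul, pow_succ]
  -- u ≤ t R u
  have h4 : ∀ u, 0 ≤ u → u ≤ t • R u := by
    intro u hu
    have := congrArg (fun S : E →L[ℝ] E => S u) h2
    simp only [mul_apply_eq_comp, sub_apply,
          smul_apply, one_apply_eq_self] at this
    have h0 : 0 ≤ T (R u) := hT _ (hR u hu)
    calc u = t • R u - T (R u) := this.symm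
      _ ≤ t • R u := sub_le_self _ h0
  refine ⟨t * ‖R‖, by positivity, fun n => (hT.pow n).opNorm_le (by positivity) fun u hu => ?_⟩
  have h5 : (T ^ n) u ≤ t • (t ^ n • R u) := by
    calc (T ^ n) u ≤ (T ^ n) (t • R u) := (hT.pow n).mono (h4 u hu)
      _ = t • (T ^ n) (R u) := by rw [map_smul]
      _ ≤ t • (t ^ n • R u) := by
        have := hsm t ht.le _ (sub_nonneg.2 (h3 u hu n))
        rw [smul_sub] at this; exact sub_nonneg.1 this
  calc ‖(T ^ n) u‖ ≤ ‖t • (t ^ n • R u)‖ := kr_norm_le_of_nonneg ((hT.pow n) u hu) h5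
    _ = t * (t ^ n * ‖R u‖) := by
      rw [norm_smul, norm_smul, Real.norm_of_nonneg ht.le, Real.norm_of_nonneg (by positivity)]
    _ ≤ t * (t ^ n * (‖R‖ * ‖u‖)) := by gcongr; exact R.le_opNorm u
    _ = _ := by ring

theorem kr_abs_le_of_pow_le {x t C : ℝ} (hx : 0 ≤ x) (ht : 0 < t)
    (h : ∀ n : ℕ, x ^ n ≤ C * t ^ n) : x ≤ t := by
  by_contra hlt
  push Not at hlt
  have h1 : 1 < x / t := (one_lt_div ht).2 hlt
  obtain ⟨n, hn⟩ := pow_unbounded_of_one_lt C h1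
  rw [div_pow, lt_div_iff₀ (by positivity)] at hn
  exact absurd (h n) (not_le.2 hn)

theorem kr_spec_le [CompleteSpace E] {T : E →L[ℝ] E} {t C : ℝ} (ht : 0 < t) (hC : 0 ≤ C)
    (h : ∀ n : ℕ, ‖T ^ n‖ ≤ C * t ^ n) {k : ℝ} (hk : k ∈ spectrum ℝ T) : |k| ≤ t := by
  refine kr_abs_le_of_pow_le (C := C * ‖(1 : E →L[ℝ] E)‖) (abs_nonneg k) ht fun n => ?_
  have h1 := spectrum.norm_le_norm_mul_of_mem (spectrum.pow_mem_pow T n hk)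
  rw [norm_pow, Real.norm_eq_abs] at h1
  calc |k| ^ n ≤ ‖T ^ n‖ * ‖(1 : E →L[ℝ] E)‖ := h1
    _ ≤ C * t ^ n * ‖(1 : E →L[ℝ] E)‖ := by gcongr; exact h n
    _ = _ := by ring

theorem kr_main [CompleteSpace E] (hsm : ∀ c : ℝ, 0 ≤ c → ∀ u : E, 0 ≤ u → 0 ≤ c • u)
    {T : E →L[ℝ] E} (hT : KRPos T) {c : ℝ} (hc : 0 < c)
    (hcP : ∀ t C : ℝ, 0 < t → 0 ≤ C → (∀ n : ℕ, ‖T ^ n‖ ≤ C * t ^ n) → c ≤ t) :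
    ∃ r : ℝ, 0 < r ∧ (∀ k ∈ spectrum ℝ T, |k| ≤ r) ∧
      ∀ ε : ℝ, 0 < ε → ∃ v : E, 0 ≤ v ∧ ‖v‖ = 1 ∧ ‖r • v - T v‖ < ε := by
  have hsmP : ∀ (X : E →L[ℝ] E) (s : ℝ), 0 ≤ s → KRPos X → KRPos (s • X) :=
    fun X s hs hX u hu => hsm s hs _ (hX u hu)
  set G : Set ℝ := {t | KRG T t} with hG
  have hlow : ∀ t ∈ G, c ≤ t := by
    intro t ht
    obtain ⟨C, hC, h⟩ := KRG.pow_le hsm hT ht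
    exact hcP t C ht.1 hC h
  have hne : G.Nonempty := by
    have hpos : 0 < ‖T‖ + 1 := by positivity
    refine ⟨‖T‖ + 1, hpos, ?_⟩
    set s := (‖T‖ + 1) with hs
    have hn : ‖s⁻¹ • T‖ < 1 := by
      rw [norm_smul, norm_inv, Real.norm_of_nonneg hpos.le, inv_mul_lt_iff₀ hpos]
      linarith
    obtain ⟨Y, hY, h1, h2⟩ := (hsmP T s⁻¹ (by positivity) hT).geom hn
    have e : s • (1 : E →L[ℝ] E) - T = s • (1 - s⁻¹ • T) := by
      rw [smul_sub, smul_smul, mul_inv_cancel₀ hpos.ne', one_smul]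
    refine ⟨s⁻¹ • Y, hsmP Y _ (by positivity) hY, ?_, ?_⟩
    · rw [e, smul_mul_smul_comm, h1, inv_mul_cancel₀ hpos.ne', one_smul]
    · rw [e, smul_mul_smul_comm, h2, mul_inv_cancel₀ hpos.ne', one_smul]
  have hbdd : BddBelow G := ⟨c, hlow⟩
  set r := sInf G with hr
  have hcr : c ≤ r := le_csInf hne hlow
  have hr0 : 0 < r := hc.trans_le hcr
  refine ⟨r, hr0, ?_, ?_⟩
  · intro k hk
    refine le_csInf hne fun t ht => ?_
    obtain ⟨C, hC, h⟩ := KRG.pow_le hsm hT ht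
    exact kr_spec_le ht.1 hC h hk
  · intro ε hε
    by_contra hcon
    push Not at hcon
    have h1 : ∀ v : E, 0 ≤ v → ε * ‖v‖ ≤ ‖r • v - T v‖ := by
      intro v hv
      by_cases h0 : v = 0
      · simp [h0]
      have hn : 0 < ‖v‖ := norm_pos_iff.2 h0
      have := hcon (‖v‖⁻¹ • v) (hsm _ (by positivity) _ hv)
        (by rw [norm_smul, norm_inv, norm_norm, inv_mul_cancel₀ hn.ne'])
      rw [map_smul, smul_comm, ← smul_sub, norm_smul, norm_inv, norm_norm,
        le_inv_mul_iff₀ hn] at this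
      linarith
    set η := min (ε / 4) (r / 3) with hη
    have hη0 : 0 < η := by positivity
    obtain ⟨t, htG, ht⟩ := exists_lt_of_csInf_lt hne (show sInf G < r + η by linarith)
    have hrt : r ≤ t := csInf_le hbdd htG
    obtain ⟨ht0, R, hR, hR1, hR2⟩ := htG
    have hRn : ‖R‖ ≤ (4 / 3) / ε := by
      refine hR.opNorm_le (by positivity) fun u hu => ?_
      have e : t • R u - T (R u) = u := congrArg (fun S : E →L[ℝ] E => S u) hR2
      have e2 : r • R u - T (R u) = u - (t - r) • R u := by
        rw [sub_smul]; nth_rewrite 3 [← e]; abel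
      have h2 := h1 (R u) (hR u hu)
      have h3 : ‖r • R u - T (R u)‖ ≤ ‖u‖ + (t - r) * ‖R u‖ := by
        rw [e2]
        refine (norm_sub_le _ _).trans ?_
        rw [norm_smul, Real.norm_of_nonneg (by linarith)]
      have h4 : (t - r) * ‖R u‖ ≤ ε / 4 * ‖R u‖ := by
        gcongr
        have := min_le_left (ε / 4) (r / 3); linarith
      rw [div_mul_eq_mul_div, le_div_iff₀ hε]
      linarith
    have hX : ‖(2 * η) • R‖ < 1 := by
      rw [norm_smul, Real.norm_of_nonneg (by positivity)]
      have h5 : η ≤ ε / 4 := min_le_left _ _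
      calc 2 * η * ‖R‖ ≤ 2 * (ε / 4) * ((4 / 3) / ε) := by gcongr
        _ = 2 / 3 := by field_simp
        _ < 1 := by norm_num
    obtain ⟨Y, hY, hY1, hY2⟩ := (hsmP R (2 * η) (by positivity) hR).geom hX
    have e1 : (t - 2 * η) • (1 : E →L[ℝ] E) - T = (t • 1 - T) * (1 - (2 * η) • R) := by
      rw [mul_sub, mul_one, mul_smul_comm, hR2, sub_smul]; abel
    have e2 : (t - 2 * η) • (1 : E →L[ℝ] E) - T = (1 - (2 * η) • R) * (t • 1 - T) := by
      rw [sub_mul, one_mul, smul_mul_assoc, hR1, sub_smul]; abel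
    have hη2 : η ≤ r / 3 := min_le_right _ _
    have hpos : 0 < t - 2 * η ∨ t - 2 * η ≤ 0 := lt_or_ge _ _
    have hlt : t - 2 * η < r := by linarith
    rcases hpos with hp | hp
    · have : t - 2 * η ∈ G := by
        refine ⟨hp, Y * R, fun u hu => hY _ (hR u hu), ?_, ?_⟩
        · rw [e1, mul_assoc, ← mul_assoc R, hR1, one_mul, hY1]
        · rw [e2]
          have : (1 - (2 * η) • R) * (t • 1 - T) * (Y * R) = 1 := by
            rw [← e2, e1]
            rw [mul_assoc, ← mul_assoc _ Y, hY2, one_mul, hR2]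
          exact this
      have := csInf_le hbdd this
      linarith
    · linarith
end KR

theorem kr_weak {H E : Type*} [NormedAddCommGroup H] [InnerProductSpace ℝ H] [CompleteSpace H]
    [NormedAddCommGroup E] [NormedSpace ℝ E] (ι : H →L[ℝ] E) (T : E →L[ℝ] E) (r B : ℝ)
    (v : ℕ → E) (φ : ℕ → H) (hφ : ∀ n, ‖φ n‖ ≤ B) (hι : ∀ n, ι (φ n) = T (v n))
    (hv : Filter.Tendsto (fun n => r • v n - T (v n)) Filter.atTop (nhds 0)) :
    ∃ w : E, T w = r • w ∧ ∀ F : StrongDual ℝ E,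
      Filter.Tendsto (fun n => F (T (v n))) (Filter.hyperfilter ℕ : Filter ℕ) (nhds (F w)) := by
  have hcomp := WeakDual.isCompact_closedBall (𝕜 := ℝ) (E := H) 0 B
  let f : ℕ → WeakDual ℝ H :=
    fun n => StrongDual.toWeakDual (InnerProductSpace.toDual ℝ H (φ n))
  have hmem : ∀ n, f n ∈ (⇑WeakDual.toStrongDual ⁻¹' Metric.closedBall (0 : StrongDual ℝ H) B) := by
    intro n
    have : ‖InnerProductSpace.toDual ℝ H (φ n)‖ ≤ B := by
      rw [LinearIsometryEquiv.norm_map]; exact hφ n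
    simpa [f] using this
  obtain ⟨x, -, hx⟩ := isCompact_iff_ultrafilter_le_nhds.1 hcomp
    ((Filter.hyperfilter ℕ).map f) (by
      rw [Filter.le_principal_iff]
      exact Filter.mem_map.2 (Filter.Eventually.of_forall hmem))
  have hx' : Filter.Tendsto f (Filter.hyperfilter ℕ : Filter ℕ) (nhds x) := hx
  set ψ : H := (InnerProductSpace.toDual ℝ H).symm (WeakDual.toStrongDual x) with hψ
  have hlim : ∀ z : H, Filter.Tendsto (fun n => inner ℝ (φ n) z) (Filter.hyperfilter ℕ : Filter ℕ)
      (nhds (inner ℝ ψ z)) := by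
    intro z
    have h1 := ((WeakDual.eval_continuous z).tendsto x).comp hx'
    have h2 : inner ℝ ψ z = x z := by
      rw [hψ, InnerProductSpace.toDual_symm_apply]; rfl
    rw [h2]
    exact h1
  have hF : ∀ F : StrongDual ℝ E,
      Filter.Tendsto (fun n => F (T (v n))) (Filter.hyperfilter ℕ : Filter ℕ)
        (nhds (F (ι ψ))) := by
    intro F
    have h1 := hlim ((InnerProductSpace.toDual ℝ H).symm (F.comp ι))
    have h2 : ∀ y : H, inner ℝ y ((InnerProductSpace.toDual ℝ H).symm (F.comp ι)) = F (ι y) := by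
      intro y
      rw [real_inner_comm, InnerProductSpace.toDual_symm_apply]; rfl
    simp only [h2, hι] at h1
    exact h1
  refine ⟨ι ψ, ?_, hF⟩
  rw [SeparatingDual.eq_iff_forall_dual_eq (R := ℝ)]
  intro F
  have h1 := hF (F.comp T)
  have h2 := (hF F).const_mul r
  have h3 : Filter.Tendsto (fun n => (F.comp T) (r • v n - T (v n)))
      (Filter.hyperfilter ℕ : Filter ℕ) (nhds 0) := by
    have := ((F.comp T).continuous.tendsto 0).comp (hv.mono_left Nat.hyperfilter_le_atTop)
    rw [map_zero] at this
    exact this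
  have h4 := h2.sub h3
  have h5 := tendsto_nhds_unique h1 (h4.congr fun n => by simp)
  rw [map_smul, smul_eq_mul]
  simpa using h5

theorem kr_lp_smul (μ : Measure ℝ) (c : ℝ) (hc : 0 ≤ c) (u : Lp ℝ 1 μ) (hu : 0 ≤ u) :
    0 ≤ c • u := by
  rw [← Lp.coeFn_nonneg] at hu ⊢
  filter_upwards [hu, Lp.coeFn_smul c u] with x hx h
  rw [h]
  exact mul_nonneg hc hx

theorem kr_lp_norm (μ : Measure ℝ) (u : Lp ℝ 1 μ) (hu : 0 ≤ u) : ‖u‖ = ∫ x, u x ∂μ := by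
  rw [← Lp.coeFn_nonneg] at hu
  rw [L1.norm_eq_integral_norm]
  refine integral_congr_ae ?_
  filter_upwards [hu] with x hx
  exact Real.norm_of_nonneg hx

theorem kr_factor (μ : Measure ℝ) (h : ℝ → ℝ) (hh : Integrable h μ) (h0 : ∀ x, 0 ≤ h x) :
    ∃ (ι : Lp ℝ 2 μ →L[ℝ] Lp ℝ 1 μ) (B : ℝ), ∀ w : Lp ℝ 1 μ, 0 ≤ w → (∀ᵐ x ∂μ, w x ≤ h x) →
      ∃ φ : Lp ℝ 2 μ, ‖φ‖ ≤ B ∧ ι φ = w := by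
  have hsm : AEStronglyMeasurable (fun x => √(h x)) μ :=
    (Real.continuous_sqrt.comp_aestronglyMeasurable hh.1)
  have hs : MemLp (fun x => √(h x)) 2 μ := by
    rw [memLp_two_iff_integrable_sq hsm]
    refine hh.congr (Filter.Eventually.of_forall fun x => ?_)
    exact (Real.sq_sqrt (h0 x)).symm
  let s : Lp ℝ 2 μ := hs.toLp _
  refine ⟨(ContinuousLinearMap.mul ℝ ℝ).holderL μ 2 2 1 s, ‖s‖, fun w hw hwh => ?_⟩
  rw [← Lp.coeFn_nonneg] at hw
  have key : ∀ᵐ x ∂μ, ‖w x / √(h x)‖ ≤ ‖√(h x)‖ := by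
    filter_upwards [hw, hwh] with x h1 h2
    have h1 : 0 ≤ w x := h1
    rw [Real.norm_of_nonneg (by positivity), Real.norm_of_nonneg (by positivity)]
    refine div_le_of_le_mul₀ (by positivity) (by positivity) ?_
    rwa [Real.mul_self_sqrt (h0 x)]
  have hm : MemLp (fun x => w x / √(h x)) 2 μ :=
    hs.mono (((Lp.aestronglyMeasurable w).aemeasurable.div hsm.aemeasurable).aestronglyMeasurable) key
  refine ⟨hm.toLp _, ?_, ?_⟩
  · refine Lp.norm_le_norm_of_ae_le ?_
    filter_upwards [key, hm.coeFn_toLp, hs.coeFn_toLp] with x h1 h2 h3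
    rw [h2, h3]; exact h1
  · apply Lp.ext
    have e := (ContinuousLinearMap.mul ℝ ℝ).coeFn_holder (r := 1) s (hm.toLp _)
    filter_upwards [e, hw, hwh, hm.coeFn_toLp, hs.coeFn_toLp] with x h1 h2 h3 h4 h5
    refine h1.trans ?_
    rw [h4, h5]
    have h2 : 0 ≤ w x := h2
    show √(h x) * (w x / √(h x)) = w x
    by_cases hz : √(h x) = 0
    · have : h x = 0 := (Real.sqrt_eq_zero (h0 x)).1 hz
      rw [hz, zero_mul]; linarith
    · field_simp

theorem kr_setIntegral (μ : Measure ℝ) (s : Set ℝ) :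
    ∃ F : StrongDual ℝ (Lp ℝ 1 μ), ∀ u, F u = ∫ x in s, u x ∂μ := by
  refine ⟨⟨⟨⟨fun u => ∫ x in s, u x ∂μ, ?_⟩, ?_⟩, continuous_setIntegral s⟩, fun u => rfl⟩
  · intro u v
    rw [integral_congr_ae (ae_restrict_of_ae (Lp.coeFn_add u v))]
    exact integral_add (L1.integrable_coeFn u).integrableOn (L1.integrable_coeFn v).integrableOn
  · intro c u
    show ∫ x in s, (c • u : Lp ℝ 1 μ) x ∂μ = c • ∫ x in s, u x ∂μ
    rw [integral_congr_ae (ae_restrict_of_ae (Lp.coeFn_smul c u))]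
    exact integral_smul c _

theorem kr_final (μ : Measure ℝ) (T : Lp ℝ 1 μ →L[ℝ] Lp ℝ 1 μ) (hT : KRPos T)
    (h : ℝ → ℝ) (hh : Integrable h μ) (h0 : ∀ x, 0 ≤ h x)
    (hTh : ∀ u : Lp ℝ 1 μ, 0 ≤ u → ‖u‖ = 1 → ∀ᵐ x ∂μ, T u x ≤ h x)
    {c : ℝ} (hc : 0 < c)
    (hcP : ∀ t C : ℝ, 0 < t → 0 ≤ C → (∀ n : ℕ, ‖T ^ n‖ ≤ C * t ^ n) → c ≤ t) :
    ∃ r : ℝ, 0 < r ∧ ENNReal.ofReal r = spectralRadius ℝ T ∧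
      ∃ u : Lp ℝ 1 μ, u ≠ 0 ∧ ((0 : ℝ → ℝ) ≤ᵐ[μ] ⇑u) ∧ T u = r • u := by
  obtain ⟨r, hr, hspec, happ⟩ := kr_main (kr_lp_smul μ) hT hc hcP
  choose v hv0 hv1 hv using fun n : ℕ => happ (1 / ((n : ℝ) + 1)) (by positivity)
  obtain ⟨ι, B, hι⟩ := kr_factor μ h hh h0
  choose φ hφ hφι using fun n => hι (T (v n)) (hT _ (hv0 n)) (hTh _ (hv0 n) (hv1 n))
  have hlim : Filter.Tendsto (fun n => r • v n - T (v n)) Filter.atTop (nhds 0) :=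
    squeeze_zero_norm (fun n => (hv n).le) tendsto_one_div_add_atTop_nhds_zero_nat
  obtain ⟨w, hw, hF⟩ := kr_weak ι T r B v φ hφ hφι hlim
  have hw0 : w ≠ 0 := by
    intro hw0
    obtain ⟨F, hFF⟩ := kr_setIntegral μ univ
    have h1 := hF F
    have h2 : ∀ n, F (T (v n)) = ‖T (v n)‖ := fun n => by
      rw [hFF, kr_lp_norm μ _ (hT _ (hv0 n)), setIntegral_univ]
    simp only [h2, hw0, map_zero] at h1
    have h3 := (hlim.mono_left Nat.hyperfilter_le_atTop).norm.add h1
    rw [norm_zero, add_zero] at h3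
    have h4 : r ≤ 0 := by
      refine ge_of_tendsto' h3 fun n => ?_
      calc r = ‖r • v n‖ := by rw [norm_smul, hv1, mul_one, Real.norm_of_nonneg hr.le]
        _ = ‖(r • v n - T (v n)) + T (v n)‖ := by rw [sub_add_cancel]
        _ ≤ _ := norm_add_le _ _
    linarith
  refine ⟨r, hr, ?_, w, hw0, ?_, hw⟩
  · apply le_antisymm
    · have hmem : r ∈ spectrum ℝ T := by
        intro hu
        rw [spectrum.mem_resolventSet_iff, Algebra.algebraMap_eq_smul_one] at hu
        obtain ⟨X, hX⟩ := hu.exists_left_inv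
        have : (X * (r • 1 - T)) w = w := by rw [hX]; rfl
        apply hw0
        rw [← this]
        show X (r • w - T w) = 0
        rw [hw, sub_self, map_zero]
      refine le_trans ?_ (le_iSup₂ (f := fun k (_ : k ∈ spectrum ℝ T) => (‖k‖₊ : ℝ≥0∞)) r hmem)
      have : (‖r‖₊ : ℝ≥0∞) = ENNReal.ofReal ‖r‖ := (ofReal_norm r).symm
      rw [this, Real.norm_of_nonneg hr.le]
    · refine iSup₂_le fun k hk => ?_
      have := ENNReal.ofReal_le_ofReal (hspec k hk)
      rwa [← Real.norm_eq_abs, ofReal_norm] at this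
  · refine ae_nonneg_of_forall_setIntegral_nonneg (L1.integrable_coeFn w) fun s _ _ => ?_
    obtain ⟨F, hFF⟩ := kr_setIntegral μ s
    rw [← hFF]
    refine ge_of_tendsto' (hF F) fun n => ?_
    rw [hFF]
    exact integral_nonneg_of_ae (ae_restrict_of_ae ((Lp.coeFn_nonneg _).2 (hT _ (hv0 n))))

/-- If J(x,y) ≤ g(x) for a.e. (x,y) ∈ Ω × Ω with g ∈ L¹(Ω), and 𝒥 is a
bounded operator on L¹(Ω) with nonzero spectral radius, then for every λ > −inf a the
operator A_λ on L¹(Ω) has a positive eigenvalue r = spr(A_λ) > 0 with a nonzero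
nonnegative eigenfunction. -/
theorem stmt_4
    (Ω : Set ℝ) (hΩ : MeasurableSet Ω)
    (a : ℝ → ℝ) (ha : Continuous a)
    (c c' : ℝ) (hc0 : 0 < c) (hcc' : c < c')
    (hbound : ∀ x ∈ Ω, c < a x ∧ a x < c')
    (J : ℝ → ℝ → ℝ) (hJmeas : Measurable (Function.uncurry J))
    (hJnonneg : ∀ x y, 0 ≤ J x y)
    -- there is g ∈ L¹(Ω) with J(x,y) ≤ g(x) for a.e. (x,y) ∈ Ω × Ω
    (g : ℝ → ℝ) (hg : Integrable g (volume.restrict Ω))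
    (hJg : ∀ᵐ p ∂((volume.restrict Ω).prod (volume.restrict Ω)),
      J p.1 p.2 ≤ g p.1)
    -- 𝒥 is a bounded operator on L¹(Ω) with nonzero spectral radius
    (𝒥 : Lp ℝ 1 (volume.restrict Ω) →L[ℝ] Lp ℝ 1 (volume.restrict Ω))
    (h𝒥 : ∀ u : Lp ℝ 1 (volume.restrict Ω),
      ⇑(𝒥 u) =ᵐ[volume.restrict Ω] fun x => ∫ y in Ω, J x y * u y)
    (h𝒥spr : spectralRadius ℝ 𝒥 ≠ 0)
    -- the family A_λ
    (A : ℝ → (Lp ℝ 1 (volume.restrict Ω) →L[ℝ] Lp ℝ 1 (volume.restrict Ω)))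
    (hA : ∀ l : ℝ, -sInf (a '' Ω) < l → ∀ u : Lp ℝ 1 (volume.restrict Ω),
      ⇑(A l u) =ᵐ[volume.restrict Ω] fun x => (𝒥 u) x / (l + a x))
    (l : ℝ) (hl : -sInf (a '' Ω) < l) :
    ∃ r : ℝ, 0 < r ∧ ENNReal.ofReal r = spectralRadius ℝ (A l) ∧
      ∃ u : Lp ℝ 1 (volume.restrict Ω), u ≠ 0 ∧
        ((0 : ℝ → ℝ) ≤ᵐ[volume.restrict Ω] ⇑u) ∧ A l u = r • u := by
  set δ := l + sInf (a '' Ω) with hδ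
  have hδ0 : 0 < δ := by linarith
  have hΩae : ∀ᵐ x ∂(volume.restrict Ω), x ∈ Ω := ae_restrict_mem hΩ
  have hδa : ∀ x ∈ Ω, δ ≤ l + a x := by
    intro x hx
    have : sInf (a '' Ω) ≤ a x := by
      refine csInf_le ⟨c, ?_⟩ ⟨x, hx, rfl⟩
      rintro _ ⟨y, hy, rfl⟩
      exact (hbound y hy).1.le
    linarith
  set M := |l| + c' with hM
  have hM0 : 0 < M := by have := abs_nonneg l; linarith
  have haM : ∀ x ∈ Ω, l + a x ≤ M := by
    intro x hx
    have := (hbound x hx).2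
    have := le_abs_self l
    linarith
  -- pointwise kernel positivity
  have hJpos : KRPos 𝒥 := by
    intro u hu
    rw [← Lp.coeFn_nonneg] at hu ⊢
    filter_upwards [h𝒥 u] with x hx
    rw [hx]
    refine integral_nonneg_of_ae ?_
    filter_upwards [hu] with y hy
    exact mul_nonneg (hJnonneg x y) hy
  have hApos : KRPos (A l) := by
    intro u hu
    have h1 := hJpos u hu
    rw [← Lp.coeFn_nonneg] at h1 ⊢
    filter_upwards [hA l hl u, h1, hΩae] with x hx h1 h2
    rw [hx]
    exact div_nonneg h1 (hδ0.le.trans (hδa x h2))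
  have hJA : ∀ u, 0 ≤ u → 𝒥 u ≤ M • A l u := by
    intro u hu
    have h1 := hJpos u hu
    rw [← Lp.coeFn_nonneg] at h1
    rw [← Lp.coeFn_le]
    filter_upwards [hA l hl u, h1, hΩae, Lp.coeFn_smul M (A l u)] with x hx h1 h2 h3
    have h1 : 0 ≤ 𝒥 u x := h1
    have hp : 0 < l + a x := hδ0.trans_le (hδa x h2)
    rw [h3, Pi.smul_apply, hx, smul_eq_mul, ← mul_div_assoc, le_div_iff₀ hp, mul_comm]
    exact mul_le_mul_of_nonneg_right (haM x h2) h1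
  have hsm := kr_lp_smul (volume.restrict Ω)
  have hJAn : ∀ n : ℕ, ∀ u, 0 ≤ u → (𝒥 ^ n) u ≤ M ^ n • ((A l) ^ n) u := by
    intro n
    induction n with
    | zero => intro u hu; simp
    | succ n ih =>
      intro u hu
      have e1 : 0 ≤ M ^ n • (((A l) ^ n) (M • A l u - 𝒥 u)) :=
        hsm _ (by positivity) _ (hApos.pow n _ (sub_nonneg.2 (hJA u hu)))
      rw [map_sub, smul_sub, sub_nonneg] at e1
      calc (𝒥 ^ (n+1)) u = (𝒥 ^ n) (𝒥 u) := by rw [pow_succ]; rfl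
        _ ≤ M ^ n • ((A l) ^ n) (𝒥 u) := ih _ (hJpos u hu)
        _ ≤ M ^ n • ((A l) ^ n) (M • A l u) := e1
        _ = M ^ (n+1) • ((A l) ^ (n+1)) u := by
          rw [map_smul, smul_smul, ← pow_succ, pow_succ (A l)]; rfl
  have hnorm : ∀ n : ℕ, ‖𝒥 ^ n‖ ≤ M ^ n * ‖(A l) ^ n‖ := by
    intro n
    refine (hJpos.pow n).opNorm_le (by positivity) fun u hu => ?_
    refine (kr_norm_le_of_nonneg (hJpos.pow n u hu) (hJAn n u hu)).trans ?_
    rw [norm_smul, Real.norm_of_nonneg (by positivity), mul_assoc]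
    gcongr
    exact ((A l) ^ n).le_opNorm u
  -- a nonzero point of the spectrum
  obtain ⟨k, hk, hk0⟩ : ∃ k ∈ spectrum ℝ 𝒥, k ≠ 0 := by
    by_contra hcon
    push Not at hcon
    apply h𝒥spr
    refine le_antisymm (iSup₂_le fun k hk => ?_) bot_le
    simp [hcon k hk]
  refine kr_final (volume.restrict Ω) (A l) hApos (fun x => |g x| / δ) (hg.abs.div_const δ)
    (fun x => by positivity) ?_ (c := |k| / M) (by positivity) ?_
  · intro u hu hu1
    have hu' := (Lp.coeFn_nonneg u).2 hu
    have hprod := Measure.ae_ae_of_ae_prod hJg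
    filter_upwards [hA l hl u, h𝒥 u, hΩae, hprod] with x h1 h2 h3 h4
    rw [h1]
    have hI : 𝒥 u x ≤ |g x| := by
      rw [h2]
      calc ∫ y in Ω, J x y * u y ≤ ∫ y in Ω, |g x| * u y := by
            refine integral_mono_of_nonneg ?_ ((L1.integrable_coeFn u).const_mul _) ?_
            · filter_upwards [hu'] with y hy
              exact mul_nonneg (hJnonneg x y) hy
            · filter_upwards [hu', h4] with y hy h5
              exact mul_le_mul_of_nonneg_right (h5.trans (le_abs_self _)) hy
        _ = |g x| := by
          rw [integral_const_mul, ← kr_lp_norm _ u hu, hu1, mul_one]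
    have hp := hδa x h3
    exact div_le_div₀ (abs_nonneg _) hI hδ0 hp
  · intro t C ht hC hP
    rw [div_le_iff₀ hM0]
    refine kr_spec_le (T := 𝒥) (C := C) (by positivity) hC (fun n => ?_) hk
    calc ‖𝒥 ^ n‖ ≤ M ^ n * ‖(A l) ^ n‖ := hnorm n
      _ ≤ M ^ n * (C * t ^ n) := by gcongr; exact hP n
      _ = C * (t * M) ^ n := by rw [mul_pow]; ring
end

section
/- Assume J is symmetric, J(x,y) = J(y,x), 𝒥 is a bounded operator on L²(Ω), and λ > −inf a. If there exists a nonzero v ∈ L²(Ω) with ⟨A_λ v, v⟩_{λ+a} > ⟨v, v⟩_{λ+a}, where ⟨f, g⟩_{λ+a} = ∫_Ω f(x) conj(g(x)) (λ + a(x)) dx, then the spectral radius of A_λ on L²(Ω) satisfies spr(A_λ) > 1. -/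
open MeasureTheory ENNReal Set

theorem aux_abs {H : Type*} [NormedAddCommGroup H] [InnerProductSpace ℝ H]
    (A W K : H →L[ℝ] H) (hWA : ∀ u, W (A u) = K u)
    (hW : ∀ u v, inner ℝ (W u) v = inner ℝ u (W v))
    (hK : ∀ u v, inner ℝ (K u) v = inner ℝ u (K v))
    (d : ℝ) (hd : 0 < d) (hcoer : ∀ u, d * ‖u‖ ^ 2 ≤ inner ℝ (W u) u)
    (v : H) (hv : v ≠ 0) (hlt : inner ℝ (W v) v < inner ℝ (K v) v) :
    1 < spectralRadius ℝ A := by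
  have hWpos : ∀ u, u ≠ 0 → 0 < inner ℝ (W u) u := by
    intro u hu
    have : 0 < ‖u‖ := norm_pos_iff.2 hu
    have := hcoer u
    have : 0 < d * ‖u‖ ^ 2 := by positivity
    linarith
  set R : H → ℝ := fun u => inner ℝ (K u) u / inner ℝ (W u) u with hR
  have hbdd : BddAbove (range R) := by
    refine ⟨‖K‖ / d, ?_⟩
    rintro _ ⟨u, rfl⟩
    by_cases hu : u = 0
    · simp [hR, hu]; positivity
    · rw [hR]
      have h1 := hWpos u hu
      show _ / _ ≤ _
      rw [div_le_div_iff₀ h1 hd]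
      have h2 : inner ℝ (K u) u ≤ ‖K‖ * ‖u‖ ^ 2 := by
        calc inner ℝ (K u) u ≤ ‖K u‖ * ‖u‖ := real_inner_le_norm _ _
          _ ≤ (‖K‖ * ‖u‖) * ‖u‖ := by gcongr; exact K.le_opNorm u
          _ = _ := by ring
      calc inner ℝ (K u) u * d ≤ ‖K‖ * ‖u‖ ^ 2 * d := by gcongr
        _ = ‖K‖ * (d * ‖u‖ ^ 2) := by ring
        _ ≤ _ := by gcongr; exact hcoer u
  set m := ⨆ u, R u with hm
  have hm1 : 1 < m := by
    refine lt_of_lt_of_le ?_ (le_ciSup hbdd v)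
    show 1 < _ / _
    rwa [one_lt_div (hWpos v hv)]
  have hmW : ∀ u, inner ℝ (K u) u ≤ m * inner ℝ (W u) u := by
    intro u
    by_cases hu : u = 0
    · simp [hu]
    · exact (div_le_iff₀ (hWpos u hu)).1 (le_ciSup hbdd u)
  have hmem : m ∈ spectrum ℝ A := by
    intro hunit
    obtain ⟨B, hB⟩ := hunit.exists_left_inv
    set P : H →L[ℝ] H := m • W - K with hP
    have hPW : ∀ u, P u = W ((algebraMap ℝ (H →L[ℝ] H) m - A) u) := by
      intro u
      simp [hP, hWA, Algebra.algebraMap_eq_smul_one]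
    have hPsym : ∀ u v, inner ℝ (P u) v = inner ℝ u (P v) := by
      intro u v
      simp [hP, inner_sub_left, inner_sub_right, inner_smul_left, inner_smul_right, hW, hK]
    have hPpos : ∀ u, 0 ≤ inner ℝ (P u) u := by
      intro u
      have := hmW u
      simp [hP, inner_sub_left, inner_smul_left]
      linarith
    have hWlow : ∀ u, d * ‖u‖ ≤ ‖W u‖ := by
      intro u
      by_cases hu : u = 0
      · simp [hu]
      · have h0 : 0 < ‖u‖ := norm_pos_iff.2 hu
        have h1 := (hcoer u).trans (real_inner_le_norm _ _)
        have : d * ‖u‖ * ‖u‖ ≤ ‖W u‖ * ‖u‖ := by nlinarith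
        exact le_of_mul_le_mul_right this h0
    have hlow : ∀ u, d * ‖u‖ ≤ (‖B‖ + 1) * ‖P u‖ := by
      intro u
      set x := (algebraMap ℝ (H →L[ℝ] H) m - A) u with hx
      have h1 : B x = u := by
        exact congrArg (fun T : H →L[ℝ] H => T u) hB
      have h2 : ‖u‖ ≤ ‖B‖ * ‖x‖ := by rw [← h1]; exact B.le_opNorm x
      have h3 := hWlow x
      rw [← hPW u] at h3
      have h4 := norm_nonneg B
      have h5 := norm_nonneg (P u)
      calc d * ‖u‖ ≤ d * (‖B‖ * ‖x‖) := by gcongr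
        _ = ‖B‖ * (d * ‖x‖) := by ring
        _ ≤ ‖B‖ * ‖P u‖ := by gcongr
        _ ≤ _ := by nlinarith
    set k := ‖P‖ + 1 with hk
    have hk0 : 0 < k := by positivity
    have hCS : ∀ u, ‖P u‖ ^ 2 ≤ k * inner ℝ (P u) u := by
      intro u
      have h := hPpos (u - k⁻¹ • P u)
      have e1 : inner ℝ (P (P u)) u = ‖P u‖ ^ 2 := by
        rw [hPsym, real_inner_self_eq_norm_sq]
      have h2 : inner ℝ (P (P u)) (P u) ≤ k * ‖P u‖ ^ 2 := by
        calc inner ℝ (P (P u)) (P u) ≤ ‖P (P u)‖ * ‖P u‖ := real_inner_le_norm _ _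
          _ ≤ (‖P‖ * ‖P u‖) * ‖P u‖ := by gcongr; exact P.le_opNorm _
          _ ≤ _ := by nlinarith [sq_nonneg (‖P u‖)]
      simp only [map_sub, map_smul, inner_sub_left, inner_sub_right, inner_smul_left,
        inner_smul_right, real_inner_self_eq_norm_sq, e1, conj_trivial] at h
      have h3 : k⁻¹ * (k⁻¹ * inner ℝ (P (P u)) (P u)) ≤ k⁻¹ * (k⁻¹ * (k * ‖P u‖ ^ 2)) := by
        gcongr
      have h4 : k⁻¹ * (k⁻¹ * (k * ‖P u‖ ^ 2)) = k⁻¹ * ‖P u‖ ^ 2 := by field_simp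
      have h5 : k⁻¹ * ‖P u‖ ^ 2 ≤ inner ℝ (P u) u := by linarith
      rwa [inv_mul_le_iff₀ hk0] at h5
    set b := ‖B‖ + 1 with hb
    have hb0 : 0 < b := by positivity
    -- coercivity of P
    set w := ‖W‖ + 1 with hw
    have hw0 : 0 < w := by positivity
    have hWup : ∀ u, inner ℝ (W u) u ≤ w * ‖u‖ ^ 2 := by
      intro u
      calc inner ℝ (W u) u ≤ ‖W u‖ * ‖u‖ := real_inner_le_norm _ _
        _ ≤ (‖W‖ * ‖u‖) * ‖u‖ := by gcongr; exact W.le_opNorm _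
        _ ≤ _ := by nlinarith [sq_nonneg (‖u‖)]
    set e := d ^ 2 / (b ^ 2 * k * w) with he
    have he0 : 0 < e := by positivity
    have hPc : ∀ u, e * inner ℝ (W u) u ≤ inner ℝ (P u) u := by
      intro u
      have h1 : (d * ‖u‖) ^ 2 ≤ (b * ‖P u‖) ^ 2 :=
        pow_le_pow_left₀ (by positivity) (hlow u) 2
      have h2 : d ^ 2 * ‖u‖ ^ 2 ≤ b ^ 2 * (k * inner ℝ (P u) u) := by
        calc _ = (d * ‖u‖) ^ 2 := by ring
          _ ≤ b ^ 2 * ‖P u‖ ^ 2 := by rw [← mul_pow]; exact h1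
          _ ≤ _ := by gcongr; exact hCS u
      calc e * inner ℝ (W u) u ≤ e * (w * ‖u‖ ^ 2) := by gcongr; exact hWup u
        _ = (d ^ 2 * ‖u‖ ^ 2) / (b ^ 2 * k) := by rw [he]; field_simp
        _ ≤ _ := by rw [div_le_iff₀ (by positivity)]; linarith
    have : m ≤ m - e := by
      have : Nonempty H := ⟨v⟩
      have hme : ∀ u, u ≠ 0 → R u ≤ m - e := by
        intro u hu
        show _ / _ ≤ _
        rw [div_le_iff₀ (hWpos u hu)]
        have := hPc u
        simp [hP, inner_sub_left, inner_smul_left] at this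
        linarith
      refine ciSup_le fun u => ?_
      by_cases hu : u = 0
      · have h1 : 1 < R v := by
          show 1 < _ / _
          rwa [one_lt_div (hWpos v hv)]
        have h2 := hme v hv
        have : R u = 0 := by simp [hR, hu]
        linarith
      · exact hme u hu
    linarith
  have h1 : (1 : ℝ≥0∞) < ‖m‖₊ := by
    have : (1 : NNReal) < ‖m‖₊ := by
      rw [← NNReal.coe_lt_coe]
      simpa using lt_of_lt_of_le hm1 (le_abs_self m)
    exact_mod_cast this
  exact lt_of_lt_of_le h1 (le_iSup₂ (f := fun (k : ℝ) (_ : k ∈ spectrum ℝ A) => (‖k‖₊ : ℝ≥0∞)) m hmem)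

theorem aux_tonelli {α : Type*} [MeasurableSpace α] (μ : Measure α) [SFinite μ]
    (j : α → α → ℝ≥0∞) (hj : Measurable (Function.uncurry j)) (hsym : ∀ x y, j x y = j y x)
    (U V : α → ℝ≥0∞) (hU : Measurable U) (hV : Measurable V) :
    ∫⁻ x, V x * ∫⁻ y, j x y * U y ∂μ ∂μ = ∫⁻ x, U x * ∫⁻ y, j x y * V y ∂μ ∂μ := by
  have h1 : ∀ x, Measurable (j x) := fun x => hj.of_uncurry_left
  have e1 : ∀ (U V : α → ℝ≥0∞), Measurable U → ∀ x,
      V x * ∫⁻ y, j x y * U y ∂μ = ∫⁻ y, V x * (j x y * U y) ∂μ := fun U V hU x =>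
    (lintegral_const_mul _ ((h1 x).mul hU)).symm
  simp_rw [e1 U V hU, e1 V U hV]
  rw [lintegral_lintegral_swap]
  · refine lintegral_congr fun x => lintegral_congr fun y => ?_
    rw [hsym y x]; ring
  · refine Measurable.aemeasurable ?_
    exact (hV.comp measurable_fst).mul (hj.mul (hU.comp measurable_snd))

theorem aux_half {α : Type*} [MeasurableSpace α] (μ : Measure α) [SFinite μ]
    (J : α → α → ℝ) (hJmeas : Measurable (Function.uncurry J))
    (hJnonneg : ∀ x y, 0 ≤ J x y) (hJsym : ∀ x y, J x y = J y x)
    (K : Lp ℝ 2 μ →L[ℝ] Lp ℝ 2 μ)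
    (hK : ∀ u : Lp ℝ 2 μ, ⇑(K u) =ᵐ[μ] fun x => ∫ y, J x y * u y ∂μ)
    (u v : Lp ℝ 2 μ) (hu : 0 ≤ u) (hv : 0 ≤ v) (E : Set α)
    (hE : E = {x | ∫⁻ y, ENNReal.ofReal (J x y) *
      (ENNReal.ofReal (u y) + ENNReal.ofReal (v y)) ∂μ = ∞}) :
    inner ℝ (K u) v = (∫⁻ x, Eᶜ.indicator (fun x => ENNReal.ofReal (v x)) x *
      ∫⁻ y, ENNReal.ofReal (J x y) *
        Eᶜ.indicator (fun y => ENNReal.ofReal (u y)) y ∂μ ∂μ).toReal := by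
  set j : α → α → ℝ≥0∞ := fun x y => ENNReal.ofReal (J x y) with hjdef
  have hj : Measurable (Function.uncurry j) := ENNReal.measurable_ofReal.comp hJmeas
  have hj1 : ∀ x, Measurable (j x) := fun x => hj.of_uncurry_left
  have hjsym : ∀ x y, j x y = j y x := fun x y => by simp only [hjdef, hJsym x y]
  set U : α → ℝ≥0∞ := fun x => ENNReal.ofReal (u x) with hUdef
  set V : α → ℝ≥0∞ := fun x => ENNReal.ofReal (v x) with hVdef
  have hmu : ∀ w : Lp ℝ 2 μ, Measurable w := fun w => (Lp.stronglyMeasurable w).measurable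
  have hU : Measurable U := (hmu u).ennreal_ofReal
  have hV : Measurable V := (hmu v).ennreal_ofReal
  have hI : ∀ W : α → ℝ≥0∞, Measurable W → Measurable fun x => ∫⁻ y, j x y * W y ∂μ :=
    fun W hW => Measurable.lintegral_prod_right' (f := fun p : α × α => j p.1 p.2 * W p.2)
      (hj.mul (hW.comp measurable_snd))
  have hEm : MeasurableSet E := by
    rw [hE]
    exact hI (fun y => U y + V y) (hU.add hV) (measurableSet_singleton _)
  -- K on nonnegative functions
  have hKpos : ∀ f : Lp ℝ 2 μ, 0 ≤ f →
      ⇑(K f) =ᵐ[μ] fun x => (∫⁻ y, j x y * ENNReal.ofReal (f y) ∂μ).toReal := by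
    intro f hf
    have hf' := (Lp.coeFn_nonneg f).2 hf
    filter_upwards [hK f] with x hx
    rw [hx, integral_eq_lintegral_of_nonneg_ae]
    · congr 1
      refine lintegral_congr fun y => ?_
      exact ENNReal.ofReal_mul (hJnonneg x y)
    · filter_upwards [hf'] with y hy
      exact mul_nonneg (hJnonneg x y) hy
    · exact ((hJmeas.of_uncurry_left (x := x)).mul (hmu f)).aestronglyMeasurable
  have hKnn : ∀ f : Lp ℝ 2 μ, 0 ≤ f → ∀ᵐ x ∂μ, 0 ≤ K f x := by
    intro f hf
    filter_upwards [hKpos f hf] with x hx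
    rw [hx]; exact ENNReal.toReal_nonneg
  have hu' := (Lp.coeFn_nonneg u).2 hu
  have hv' := (Lp.coeFn_nonneg v).2 hv
  have hzero : ∀ q : Lp ℝ 2 μ, 0 ≤ q → q ≤ u + v → ∀ᵐ x ∂μ, x ∈ E → K q x = 0 := by
    intro q hq hqs
    have hs : K (u + v) = K q + K (u + v - q) := by rw [← map_add]; congr 1; abel
    have hadd := Lp.coeFn_add (K q) (K (u + v - q))
    rw [← hs] at hadd
    filter_upwards [hadd, hKnn q hq, hKnn _ (sub_nonneg.2 hqs),
      hKpos (u + v) (add_nonneg hu hv)] with x h1 h2 h3 h4 hxE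
    have h5 : ∫⁻ y, j x y * ENNReal.ofReal ((u + v : Lp ℝ 2 μ) y) ∂μ = ∞ := by
      rw [hE] at hxE
      rw [← show _ = _ from hxE]
      refine lintegral_congr_ae ?_
      filter_upwards [Lp.coeFn_add u v, hu', hv'] with y hy hy1 hy2
      rw [hy, Pi.add_apply, ENNReal.ofReal_add hy1 hy2]
    rw [h5] at h4
    simp only [ENNReal.toReal_top] at h4
    rw [h4, Pi.add_apply] at h1
    linarith
  -- rewrite of the inner product
  have hint : Integrable (fun x => v x * K u x) μ := by
    have := L2.integrable_inner (𝕜 := ℝ) (K u) v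
    simpa using this
  have hin : inner ℝ (K u) v = (∫⁻ x, V x * ENNReal.ofReal (K u x) ∂μ).toReal := by
    rw [L2.inner_def]
    rw [integral_eq_lintegral_of_nonneg_ae]
    · congr 1
      refine lintegral_congr_ae ?_
      filter_upwards [hv'] with x hx
      simp only [RCLike.inner_apply, conj_trivial]
      exact ENNReal.ofReal_mul hx
    · filter_upwards [hv', hKnn u hu] with x hx hx2
      simp only [RCLike.inner_apply, conj_trivial]
      exact mul_nonneg hx hx2
    · simpa using hint.aestronglyMeasurable
  have hfin : ∫⁻ x, V x * ENNReal.ofReal (K u x) ∂μ ≠ ∞ := by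
    have h := hint.lintegral_lt_top.ne
    rwa [lintegral_congr_ae] at h
    filter_upwards [hv'] with x hx
    exact ENNReal.ofReal_mul hx
  set UE := E.indicator U with hUE
  set UC := Eᶜ.indicator U with hUC
  set VC := Eᶜ.indicator V with hVC
  have hUEm : Measurable UE := hU.indicator hEm
  have hUCm : Measurable UC := hU.indicator hEm.compl
  have hVCm : Measurable VC := hV.indicator hEm.compl
  have hsplit : ∫⁻ x, V x * ENNReal.ofReal (K u x) ∂μ =
      ∫⁻ x, VC x * ∫⁻ y, j x y * UE y ∂μ ∂μ + ∫⁻ x, VC x * ∫⁻ y, j x y * UC y ∂μ ∂μ := by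
    have hm1 : Measurable fun x => VC x * ∫⁻ y, j x y * UE y ∂μ := hVCm.mul (hI UE hUEm)
    rw [← lintegral_add_left hm1]
    refine lintegral_congr_ae ?_
    filter_upwards [hzero u hu (le_add_of_nonneg_right hv), hKpos u hu] with x h1 h2
    by_cases hx : x ∈ E
    · simp [hVC, hx, h1 hx]
    · have e1 : VC x = V x := by simp [hVC, hx]
      have e2 : ∫⁻ y, j x y * U y ∂μ ≠ ∞ := by
        intro h
        apply hx
        rw [hE]
        refine top_le_iff.1 (h.symm.le.trans (lintegral_mono fun y => ?_))
        gcongr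
        exact le_self_add
      have hm2 : Measurable fun y => j x y * UE y := (hj1 x).mul hUEm
      rw [h2, ENNReal.ofReal_toReal e2, e1, ← mul_add, ← lintegral_add_left hm2]
      congr 1
      refine lintegral_congr fun y => ?_
      rw [← mul_add]
      congr 1
      exact (congrFun (Set.indicator_self_add_compl E U) y).symm
  have hz : ∫⁻ x, VC x * ∫⁻ y, j x y * UE y ∂μ ∂μ = 0 := by
    have hf1 : ∫⁻ x, VC x * ∫⁻ y, j x y * UE y ∂μ ∂μ ≠ ∞ := by
      intro h
      rw [hsplit, h] at hfin
      simp at hfin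
    rw [aux_tonelli μ j hj hjsym UE VC hUEm hVCm] at hf1 ⊢
    have hmeas : Measurable fun x => UE x * ∫⁻ y, j x y * VC y ∂μ := hUEm.mul (hI VC hVCm)
    rw [lintegral_eq_zero_iff hmeas]
    set q : Lp ℝ 2 μ := ((Lp.memLp v).indicator hEm.compl).toLp with hq
    have hqc : ⇑q =ᵐ[μ] Eᶜ.indicator v := MemLp.coeFn_toLp _
    have hq0 : 0 ≤ q := by
      rw [← Lp.coeFn_nonneg]
      filter_upwards [hqc, hv'] with x hx hx2
      rw [hx]
      exact Set.indicator_apply_nonneg fun _ => hx2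
    have hqv : q ≤ v := by
      rw [← Lp.coeFn_le]
      filter_upwards [hqc, hv'] with x hx hx2
      rw [hx]
      exact Set.indicator_apply_le' (fun _ => le_rfl) (fun _ => hx2)
    filter_upwards [ae_lt_top hmeas hf1, hKpos q hq0,
      hzero q hq0 (hqv.trans (le_add_of_nonneg_left hu))] with x h1 h2 h3
    by_cases hx : x ∈ E
    · have e : ∫⁻ y, j x y * ENNReal.ofReal (q y) ∂μ = ∫⁻ y, j x y * VC y ∂μ := by
        refine lintegral_congr_ae ?_
        filter_upwards [hqc] with y hy
        rw [hy]
        by_cases hyE : y ∈ E <;> simp [hVC, hyE, hVdef]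
      rw [h3 hx, e] at h2
      rcases (ENNReal.toReal_eq_zero_iff _).1 h2.symm with h | h
      · simp [h]
      · rw [h] at h1 ⊢
        by_contra hne
        have : UE x ≠ 0 := fun h0 => hne (by simp [h0])
        rw [ENNReal.mul_top this] at h1
        exact lt_irrefl _ h1
    · simp [hUE, hx]
  rw [hin, hsplit, hz, zero_add]

theorem aux_sym {α : Type*} [MeasurableSpace α] (μ : Measure α) [SFinite μ]
    (J : α → α → ℝ) (hJmeas : Measurable (Function.uncurry J))
    (hJnonneg : ∀ x y, 0 ≤ J x y) (hJsym : ∀ x y, J x y = J y x)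
    (K : Lp ℝ 2 μ →L[ℝ] Lp ℝ 2 μ)
    (hK : ∀ u : Lp ℝ 2 μ, ⇑(K u) =ᵐ[μ] fun x => ∫ y, J x y * u y ∂μ)
    (u v : Lp ℝ 2 μ) : inner ℝ (K u) v = inner ℝ u (K v) := by
  have hpos : ∀ u v : Lp ℝ 2 μ, 0 ≤ u → 0 ≤ v → inner ℝ (K u) v = inner ℝ u (K v) := by
    intro u v hu hv
    rw [real_inner_comm (K v) u]
    have hmu : ∀ w : Lp ℝ 2 μ, Measurable w := fun w => (Lp.stronglyMeasurable w).measurable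
    set E : Set α := {x | ∫⁻ y, ENNReal.ofReal (J x y) *
      (ENNReal.ofReal (u y) + ENNReal.ofReal (v y)) ∂μ = ∞} with hE
    have hEm : MeasurableSet E := by
      have : Measurable fun x => ∫⁻ y, ENNReal.ofReal (J x y) *
          (ENNReal.ofReal (u y) + ENNReal.ofReal (v y)) ∂μ :=
        Measurable.lintegral_prod_right' (f := fun p : α × α => ENNReal.ofReal (J p.1 p.2) *
          (ENNReal.ofReal (u p.2) + ENNReal.ofReal (v p.2)))
        (hJmeas.ennreal_ofReal.mul (((hmu u).comp measurable_snd).ennreal_ofReal.add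
          ((hmu v).comp measurable_snd).ennreal_ofReal))
      exact this (measurableSet_singleton _)
    rw [aux_half μ J hJmeas hJnonneg hJsym K hK u v hu hv E hE,
      aux_half μ J hJmeas hJnonneg hJsym K hK v u hv hu E (by rw [hE]; simp only [add_comm])]
    congr 1
    exact aux_tonelli μ (fun x y => ENNReal.ofReal (J x y)) hJmeas.ennreal_ofReal
      (fun x y => by simp only [hJsym x y]) _ _
      ((hmu u).ennreal_ofReal.indicator hEm.compl) ((hmu v).ennreal_ofReal.indicator hEm.compl)
  rw [← posPart_sub_negPart u, ← posPart_sub_negPart v]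
  simp only [map_sub, inner_sub_left, inner_sub_right]
  rw [hpos _ _ (posPart_nonneg u) (posPart_nonneg v), hpos _ _ (posPart_nonneg u) (negPart_nonneg v),
    hpos _ _ (negPart_nonneg u) (posPart_nonneg v), hpos _ _ (negPart_nonneg u) (negPart_nonneg v)]

/-- If J is symmetric, 𝒥 is bounded on L²(Ω), λ > −inf a, and there is a
nonzero v ∈ L²(Ω) with ⟨A_λ v, v⟩_{λ+a} > ⟨v, v⟩_{λ+a}, where
⟨f, g⟩_{λ+a} = ∫_Ω f(x) conj(g(x)) (λ + a(x)) dx, then spr(A_λ) > 1 on L²(Ω). -/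
theorem stmt_18
    (Ω : Set ℝ) (hΩ : MeasurableSet Ω)
    (a : ℝ → ℝ) (ha : Continuous a)
    (c c' : ℝ) (hc0 : 0 < c) (hcc' : c < c')
    (hbound : ∀ x ∈ Ω, c < a x ∧ a x < c')
    (J : ℝ → ℝ → ℝ) (hJmeas : Measurable (Function.uncurry J))
    (hJnonneg : ∀ x y, 0 ≤ J x y)
    -- J is symmetric
    (hJsym : ∀ x y, J x y = J y x)
    -- 𝒥 is a bounded operator on L²(Ω)
    (𝒥 : Lp ℝ 2 (volume.restrict Ω) →L[ℝ] Lp ℝ 2 (volume.restrict Ω))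
    (h𝒥 : ∀ u : Lp ℝ 2 (volume.restrict Ω),
      ⇑(𝒥 u) =ᵐ[volume.restrict Ω] fun x => ∫ y in Ω, J x y * u y)
    -- the operator A_λ on L²(Ω), λ > −inf a
    (l : ℝ) (hl : -sInf (a '' Ω) < l)
    (A : Lp ℝ 2 (volume.restrict Ω) →L[ℝ] Lp ℝ 2 (volume.restrict Ω))
    (hA : ∀ u : Lp ℝ 2 (volume.restrict Ω),
      ⇑(A u) =ᵐ[volume.restrict Ω] fun x => (𝒥 u) x / (l + a x))
    -- there is a nonzero v with ⟨A_λ v, v⟩_{λ+a} > ⟨v, v⟩_{λ+a}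
    (v : Lp ℝ 2 (volume.restrict Ω)) (hv : v ≠ 0)
    (hineq : (∫ x in Ω, v x * (starRingEnd ℝ) (v x) * (l + a x)) <
      ∫ x in Ω, (A v) x * (starRingEnd ℝ) (v x) * (l + a x)) :
    1 < spectralRadius ℝ A := by
  have hne : Ω.Nonempty := by
    by_contra h
    rw [Set.not_nonempty_iff_eq_empty] at h
    subst h
    apply hv
    rw [Lp.eq_zero_iff_ae_eq_zero]
    simp [Filter.EventuallyEq]
  have hbb : BddBelow (a '' Ω) := ⟨c, by rintro _ ⟨x, hx, rfl⟩; exact (hbound x hx).1.le⟩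
  set d := l + sInf (a '' Ω) with hd
  have hd0 : 0 < d := by linarith
  have hlow : ∀ᵐ x ∂(volume.restrict Ω), d ≤ l + a x := by
    filter_upwards [ae_restrict_mem hΩ] with x hx
    have := csInf_le hbb (mem_image_of_mem a hx)
    linarith
  have hwm : AEStronglyMeasurable (fun x => l + a x) (volume.restrict Ω) :=
    (continuous_const.add ha).aestronglyMeasurable
  have hw : MemLp (fun x => l + a x) ∞ (volume.restrict Ω) := by
    refine memLp_top_of_bound hwm (l + c') ?_
    filter_upwards [hlow, ae_restrict_mem hΩ] with x hx hx2
    rw [Real.norm_eq_abs, abs_of_nonneg (by linarith)]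
    linarith [(hbound x hx2).2]
  let W : Lp ℝ 2 (volume.restrict Ω) →L[ℝ] Lp ℝ 2 (volume.restrict Ω) :=
    (ContinuousLinearMap.mul ℝ ℝ).holderL (volume.restrict Ω) ∞ 2 2 hw.toLp
  have hW : ∀ u : Lp ℝ 2 (volume.restrict Ω), ⇑(W u) =ᵐ[(volume.restrict Ω)] fun x => (l + a x) * u x := by
    intro u
    have h1 : ⇑(W u) =ᵐ[(volume.restrict Ω)] fun x => (hw.toLp : Lp ℝ ∞ (volume.restrict Ω)) x * u x :=
      (ContinuousLinearMap.mul ℝ ℝ).coeFn_holder (r := 2) hw.toLp u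
    filter_upwards [h1, hw.coeFn_toLp] with x hx hx2
    rw [hx, hx2]
  refine aux_abs A W 𝒥 ?_ ?_ (aux_sym (volume.restrict Ω) J hJmeas hJnonneg hJsym 𝒥 h𝒥) d hd0 ?_ v hv ?_
  · intro u
    apply Lp.ext
    filter_upwards [hW (A u), hA u, hlow] with x h1 h2 h3
    rw [h1, h2]
    have : l + a x ≠ 0 := by linarith
    field_simp
  · intro u z
    rw [L2.inner_def, L2.inner_def]
    refine integral_congr_ae ?_
    filter_upwards [hW u, hW z] with x h1 h2
    simp only [RCLike.inner_apply, conj_trivial, h1, h2]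
    ring
  · intro u
    rw [← real_inner_self_eq_norm_sq, L2.inner_def, L2.inner_def, ← integral_const_mul]
    refine integral_mono_ae ((L2.integrable_inner u u).const_mul d)
      (L2.integrable_inner (W u) u) ?_
    filter_upwards [hW u, hlow] with x h1 h2
    simp only [RCLike.inner_apply, conj_trivial, h1]
    nlinarith [mul_self_nonneg (u x)]
  · rw [L2.inner_def, L2.inner_def]
    convert hineq using 1
    · refine integral_congr_ae ?_
      filter_upwards [hW v] with x h1
      simp only [RCLike.inner_apply, conj_trivial, h1]
      ring
    · refine integral_congr_ae ?_
      filter_upwards [hA v, hlow] with x h1 h2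
      simp only [RCLike.inner_apply, conj_trivial, h1]
      have : l + a x ≠ 0 := by linarith
      field_simp
end
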